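/- arXiv:1205.2334 — 12 statements merged into one kernel-verified Lean document; each statement's English description precedes it below -/
import Mathlib

section
/- Let x* be a local minimizer of the problem (P1): minimize f(x) over x in X subject to g(x) ≤ 0 componentwise, h(x) = 0, and ‖x_J‖₀ ≤ r. Let J* ⊆ J be an index set with |J*| = r such that x*_j = 0 for all j in J̄* := J \ J*. Suppose Robinson's condition holds at x* relative to J̄*, namely: for every (a, b, c) in ℝ^m × ℝ^p × ℝ^{J̄*} there exist a vector d in the tangent cone T_X(x*) and a vector v in ℝ^m with v_i ≤ 0 for every index i with g_i(x*) = 0, such that g'(x*)d − v = a, h'(x*)d = b, and the subvector of d indexed by J̄* equals c (here g'(x*) and h'(x*) denote the Jacobians of g and h at x*). Then there exists (λ*, μ*, z*) in ℝ^m × ℝ^p × ℝ^n such that: (i) −∇f(x*) − Σ_i λ*_i ∇g_i(x*) − Σ_j μ*_j ∇h_j(x*) − z* lies in the normal cone N_X(x*); (ii) λ*_i ≥ 0 and λ*_i g_i(x*) = 0 for i = 1, …, m; and (iii) z*_j = 0 for every j not in J̄* (i.e., for every j in the complement of J in {1, …, n} and every j in J*). -/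
open Finset

/-- The squared positive part is differentiable, with derivative twice the positive part. -/
theorem hasDerivAt_max_zero_sq (t : ℝ) :
    HasDerivAt (fun s : ℝ => max s 0 ^ 2) (2 * max t 0) t := by
  have hlin : HasDerivAt (fun s : ℝ => 2 * max t 0 * (s - t)) (2 * max t 0) t := by
    simpa using ((hasDerivAt_id t).sub_const t).const_mul (2 * max t 0)
  have hbig : (fun s : ℝ => max s 0 ^ 2 - 2 * max t 0 * (s - t)
      - max t 0 ^ 2) =O[nhds t] fun s => ‖s - t‖ ^ 2 := by
    refine Asymptotics.IsBigO.of_bound 1 (Filter.Eventually.of_forall fun s => ?_)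
    rw [Real.norm_eq_abs, norm_pow, norm_norm, Real.norm_eq_abs, sq_abs, one_mul, abs_le]
    rcases max_cases s 0 with ⟨hs, _⟩ | ⟨hs, _⟩ <;> rcases max_cases t 0 with ⟨ht, _⟩ | ⟨ht, _⟩ <;>
      rw [hs, ht] <;> constructor <;> nlinarith [sq_nonneg (s - t), sq_nonneg s, sq_nonneg t]
  have hrem : HasDerivAt (fun s : ℝ => max s 0 ^ 2 - 2 * max t 0 * (s - t) - max t 0 ^ 2) 0 t := by
    have := (hbig.hasFDerivAt one_lt_two).hasDerivAt
    simpa using this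
  have hsum := (hrem.fun_add hlin).add_const (max t 0 ^ 2)
  rw [zero_add] at hsum
  exact hsum.congr_of_eventuallyEq (Filter.Eventually.of_forall fun s => by ring)

section FritzJohn

variable {E ι κ : Type*} [NormedAddCommGroup E] [NormedSpace ℝ E] [FiniteDimensional ℝ E]
  [Fintype ι] [Fintype κ]

/-- Near a strict local minimizer there are normalized approximate Fritz John multipliers, obtained
by minimizing a quadratic penalty function. -/
theorem exists_approx_fritzJohn {X : Set E} (hXclosed : IsClosed X) (hXconv : Convex ℝ X)
    {f : E → ℝ} {g : ι → E → ℝ} {h : κ → E → ℝ} (hf : ContDiff ℝ 1 f)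
    (hg : ∀ i, ContDiff ℝ 1 (g i)) (hh : ∀ j, ContDiff ℝ 1 (h j)) {x₀ : E} (hx₀ : x₀ ∈ X)
    (hg₀ : ∀ i, g i x₀ ≤ 0) (hh₀ : ∀ j, h j x₀ = 0) {δ : ℝ} (hδ : 0 < δ)
    (hmin : ∀ x ∈ X, (∀ i, g i x ≤ 0) → (∀ j, h j x = 0) → ‖x - x₀‖ ≤ δ → x ≠ x₀ → f x₀ < f x) :
    ∃ y ∈ X, ‖y - x₀‖ < δ ∧ ∃ Λ : ℝ × (ι → ℝ) × (κ → ℝ), ‖Λ‖ = 1 ∧ 0 ≤ Λ.1 ∧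
      (∀ i, 0 ≤ Λ.2.1 i ∧ (g i y ≤ 0 → Λ.2.1 i = 0)) ∧
      ∀ x ∈ X, 0 ≤ Λ.1 * fderiv ℝ f y (x - y) + ∑ i, Λ.2.1 i * fderiv ℝ (g i) y (x - y)
        + ∑ j, Λ.2.2 j * fderiv ℝ (h j) y (x - y) := by
  have : ProperSpace E := FiniteDimensional.proper ℝ E
  set P : E → ℝ := fun x => ∑ i, max (g i x) 0 ^ 2 + ∑ j, h j x ^ 2 with hP
  have hPnonneg : ∀ x, 0 ≤ P x := fun x => by positivity
  have hPcont : Continuous P := by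
    have := fun i => (hg i).continuous
    have := fun j => (hh j).continuous
    fun_prop
  have hP₀ : P x₀ = 0 := by simp [hP, hh₀, hg₀]
  have hPzero : ∀ x, P x = 0 → (∀ i, g i x ≤ 0) ∧ ∀ j, h j x = 0 := by
    intro x hx
    obtain ⟨h1, h2⟩ := (add_eq_zero_iff_of_nonneg (by positivity) (by positivity)).1 hx
    rw [Finset.sum_eq_zero_iff_of_nonneg fun _ _ => sq_nonneg _] at h1 h2
    exact ⟨fun i => by simpa using h1 i (Finset.mem_univ i),
      fun j => by simpa using h2 j (Finset.mem_univ j)⟩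
  obtain ⟨k, hk⟩ : ∃ k : ℕ, X ∩ Metric.sphere x₀ δ ⊆ {x | f x₀ < f x + k * P x} := by
    refine ((isCompact_sphere x₀ δ).inter_left hXclosed).elim_directed_cover _
      (fun k => isOpen_lt continuous_const
        (hf.continuous.add (continuous_const.mul hPcont))) ?_ ?_
    · rintro x ⟨hxX, hxs⟩
      rw [mem_sphere_iff_norm] at hxs
      rw [Set.mem_iUnion]
      rcases (hPnonneg x).eq_or_lt with h0 | h0
      · refine ⟨0, ?_⟩
        obtain ⟨h1, h2⟩ := hPzero x h0.symm
        have := hmin x hxX h1 h2 hxs.le (by rintro rfl; simp at hxs; exact hδ.ne hxs)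
        simpa using this
      · obtain ⟨k, hk⟩ := exists_nat_gt ((f x₀ - f x) / P x)
        refine ⟨k, ?_⟩
        rw [div_lt_iff₀ h0] at hk
        simp only [Set.mem_ofPred_eq]
        linarith
    · refine Monotone.directed_le fun a b hab x hx => ?_
      have : (a : ℝ) * P x ≤ b * P x :=
        mul_le_mul_of_nonneg_right (by exact_mod_cast hab) (hPnonneg x)
      simp only [Set.mem_ofPred_eq] at hx ⊢
      linarith
  obtain ⟨y, ⟨hyX, hyB⟩, hymin⟩ :=
    ((isCompact_closedBall x₀ δ).inter_left hXclosed).exists_isMinOn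
      ⟨x₀, hx₀, Metric.mem_closedBall_self hδ.le⟩
      (hf.continuous.add ((continuous_const (y := (k : ℝ))).mul hPcont)).continuousOn
  have hyle : f y + k * P y ≤ f x₀ := by
    have := hymin (show x₀ ∈ X ∩ Metric.closedBall x₀ δ from
      ⟨hx₀, Metric.mem_closedBall_self hδ.le⟩)
    simpa [hP₀] using this
  have hyδ : ‖y - x₀‖ < δ := by
    rw [mem_closedBall_iff_norm] at hyB
    refine lt_of_le_of_ne hyB fun heq => ?_
    exact (hk ⟨hyX, mem_sphere_iff_norm.2 heq⟩).not_ge hyle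
  have hyloc : IsLocalMinOn (fun x => f x + k * P x) X y := by
    have hball : Metric.ball x₀ δ ∈ nhds y :=
      Metric.isOpen_ball.mem_nhds (mem_ball_iff_norm.2 hyδ)
    filter_upwards [self_mem_nhdsWithin, mem_nhdsWithin_of_mem_nhds hball] with x hxX hxB
    exact hymin ⟨hxX, Metric.ball_subset_closedBall hxB⟩
  have hderiv : HasFDerivAt (fun x => f x + k * P x) (fderiv ℝ f y + (k : ℝ) •
      (∑ i, (2 * max (g i y) 0) • fderiv ℝ (g i) y + ∑ j, (2 * h j y) • fderiv ℝ (h j) y)) y := by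
    refine (hf.differentiable one_ne_zero y).hasFDerivAt.add (HasFDerivAt.const_mul ?_ _)
    refine HasFDerivAt.add (HasFDerivAt.fun_sum fun i _ => ?_) (HasFDerivAt.fun_sum fun j _ => ?_)
    · exact (hasDerivAt_max_zero_sq (g i y)).comp_hasFDerivAt y
        ((hg i).differentiable one_ne_zero y).hasFDerivAt
    · simpa using ((hh j).differentiable one_ne_zero y).hasFDerivAt.pow 2
  set Λ : ℝ × (ι → ℝ) × (κ → ℝ) :=
    (1, fun i => k * (2 * max (g i y) 0), fun j => k * (2 * h j y)) with hΛ
  have hΛpos : 0 < ‖Λ‖ := norm_pos_iff.2 fun h0 => one_ne_zero (congrArg Prod.fst h0)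
  refine ⟨y, hyX, hyδ, ‖Λ‖⁻¹ • Λ, ?_, ?_, fun i => ⟨?_, fun hi => ?_⟩, fun x hx => ?_⟩
  · rw [norm_smul, norm_inv, norm_norm, inv_mul_cancel₀ hΛpos.ne']
  · simp [hΛ]
  · simp only [Prod.smul_snd, Prod.smul_fst, Pi.smul_apply, smul_eq_mul, hΛ]
    positivity
  · simp [hΛ, hi]
  · have hvar := hyloc.hasFDerivWithinAt_nonneg hderiv.hasFDerivWithinAt
      (sub_mem_posTangentConeAt_of_segment_subset (hXconv.segment_subset hyX hx))
    have hscale : 0 ≤ ‖Λ‖⁻¹ * _ := mul_nonneg (by positivity) hvar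
    convert hscale using 1
    simp only [hΛ, Prod.smul_fst, Prod.smul_snd, Pi.smul_apply, smul_eq_mul,
      add_apply, smul_apply, _root_.sum_apply,
      mul_add, Finset.mul_sum, mul_assoc, add_assoc, one_mul]

/-- **Fritz John conditions** at a strict local minimizer over a closed convex set with smooth
inequality and equality constraints. -/
theorem exists_fritzJohn {X : Set E} (hXclosed : IsClosed X) (hXconv : Convex ℝ X)
    {f : E → ℝ} {g : ι → E → ℝ} {h : κ → E → ℝ} (hf : ContDiff ℝ 1 f)
    (hg : ∀ i, ContDiff ℝ 1 (g i)) (hh : ∀ j, ContDiff ℝ 1 (h j)) {x₀ : E} (hx₀ : x₀ ∈ X)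
    (hg₀ : ∀ i, g i x₀ ≤ 0) (hh₀ : ∀ j, h j x₀ = 0) {ε : ℝ} (hε : 0 < ε)
    (hmin : ∀ x ∈ X, (∀ i, g i x ≤ 0) → (∀ j, h j x = 0) → ‖x - x₀‖ < ε → x ≠ x₀ → f x₀ < f x) :
    ∃ Λ : ℝ × (ι → ℝ) × (κ → ℝ), Λ ≠ 0 ∧ 0 ≤ Λ.1 ∧
      (∀ i, 0 ≤ Λ.2.1 i ∧ Λ.2.1 i * g i x₀ = 0) ∧
      ∀ x ∈ X, 0 ≤ Λ.1 * fderiv ℝ f x₀ (x - x₀) + ∑ i, Λ.2.1 i * fderiv ℝ (g i) x₀ (x - x₀)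
        + ∑ j, Λ.2.2 j * fderiv ℝ (h j) x₀ (x - x₀) := by
  have happrox := fun k : ℕ =>
    exists_approx_fritzJohn hXclosed hXconv hf hg hh hx₀ hg₀ hh₀
      (δ := ε / 2 * (1 / ((k : ℝ) + 1))) (by positivity)
      (fun x hxX hxg hxh hxδ => hmin x hxX hxg hxh (hxδ.trans_lt (by
        have : 1 / ((k : ℝ) + 1) ≤ 1 := by
          rw [div_le_one (by positivity)]
          linarith [(Nat.cast_nonneg k : (0 : ℝ) ≤ k)]
        nlinarith)))
  choose y hyX hyδ Λ hΛ1 hΛ0 hΛg hΛvar using happrox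
  have hy : Filter.Tendsto y Filter.atTop (nhds x₀) := by
    rw [tendsto_iff_norm_sub_tendsto_zero]
    refine squeeze_zero (fun _ => norm_nonneg _) (fun k => (hyδ k).le) ?_
    simpa using (tendsto_one_div_add_atTop_nhds_zero_nat (𝕜 := ℝ)).const_mul (ε / 2)
  obtain ⟨L, hL, φ, hφ, hlim⟩ :=
    (isCompact_sphere (0 : ℝ × (ι → ℝ) × (κ → ℝ)) 1).tendsto_subseq (x := Λ)
      (fun k => mem_sphere_zero_iff_norm.2 (hΛ1 k))
  have hyφ := hy.comp hφ.tendsto_atTop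
  have hlim1 : Filter.Tendsto (fun k => (Λ (φ k)).1) Filter.atTop (nhds L.1) :=
    (continuous_fst.tendsto L).comp hlim
  have hlimg : ∀ i, Filter.Tendsto (fun k => (Λ (φ k)).2.1 i) Filter.atTop (nhds (L.2.1 i)) :=
    fun i => (((continuous_apply i).comp (continuous_fst.comp continuous_snd)).tendsto L).comp hlim
  have hlimh : ∀ j, Filter.Tendsto (fun k => (Λ (φ k)).2.2 j) Filter.atTop (nhds (L.2.2 j)) :=
    fun j => (((continuous_apply j).comp (continuous_snd.comp continuous_snd)).tendsto L).comp hlim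
  refine ⟨L, ?_, ?_, fun i => ⟨?_, ?_⟩, fun x hx => ?_⟩
  · rintro rfl
    simp at hL
  · exact ge_of_tendsto' hlim1 fun k => hΛ0 _
  · exact ge_of_tendsto' (hlimg i) fun k => (hΛg _ i).1
  · rcases (hg₀ i).lt_or_eq with hi | hi
    · have hev : ∀ᶠ k in Filter.atTop, (Λ (φ k)).2.1 i = 0 := by
        filter_upwards [((hg i).continuous.tendsto x₀).comp hyφ |>.eventually (gt_mem_nhds hi)]
          with k hk
        exact (hΛg _ i).2 (le_of_lt hk)
      rw [tendsto_nhds_unique (hlimg i) (tendsto_const_nhds.congr' (hev.mono fun _ h => h.symm)),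
        zero_mul]
    · rw [hi, mul_zero]
  · have hd : ∀ u : E → ℝ, ContDiff ℝ 1 u → Filter.Tendsto
        (fun k => fderiv ℝ u (y (φ k)) (x - y (φ k))) Filter.atTop
        (nhds (fderiv ℝ u x₀ (x - x₀))) := fun u hu =>
      (((hu.continuous_fderiv one_ne_zero).clm_apply (continuous_const.sub continuous_id)).tendsto
        x₀).comp hyφ
    exact ge_of_tendsto' (((hlim1.mul (hd f hf)).add
      (tendsto_finsetSum _ fun i _ => (hlimg i).mul (hd _ (hg i)))).add
      (tendsto_finsetSum _ fun j _ => (hlimh j).mul (hd _ (hh j)))) fun k => hΛvar _ x hx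

end FritzJohn

/-- First-order necessary optimality conditions for the cardinality-constrained
problem (P1): `min f(x)` s.t. `x ∈ X`, `g(x) ≤ 0`, `h(x) = 0`, `‖x_J‖₀ ≤ r`. -/
theorem first_order_necessary_P1
    {n m p : ℕ} (X : Set (Fin n → ℝ)) (hXclosed : IsClosed X) (hXconv : Convex ℝ X)
    (f : (Fin n → ℝ) → ℝ) (g : (Fin n → ℝ) → Fin m → ℝ) (h : (Fin n → ℝ) → Fin p → ℝ)
    (hf : ContDiff ℝ 1 f) (hg : ∀ i, ContDiff ℝ 1 fun x => g x i)
    (hh : ∀ j, ContDiff ℝ 1 fun x => h x j)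
    (J : Finset (Fin n)) (r : ℕ) (hr : r ≤ J.card)
    (xs : Fin n → ℝ)
    -- gradients of f, g, h at x*
    (fgrad : Fin n → ℝ) (gJac : Fin m → Fin n → ℝ) (hJac : Fin p → Fin n → ℝ)
    (hfd : HasFDerivAt f (∑ j, fgrad j • (ContinuousLinearMap.proj j : (Fin n → ℝ) →L[ℝ] ℝ)) xs)
    (hgd : ∀ i, HasFDerivAt (fun x => g x i)
      (∑ j, gJac i j • (ContinuousLinearMap.proj j : (Fin n → ℝ) →L[ℝ] ℝ)) xs)
    (hhd : ∀ i, HasFDerivAt (fun x => h x i)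
      (∑ j, hJac i j • (ContinuousLinearMap.proj j : (Fin n → ℝ) →L[ℝ] ℝ)) xs)
    -- x* is a local minimizer of (P1)
    (hfeas : xs ∈ X ∧ (∀ i, g xs i ≤ 0) ∧ (∀ j, h xs j = 0) ∧
      (J.filter fun j => xs j ≠ 0).card ≤ r)
    (hlocmin : ∃ ε > 0, ∀ x, x ∈ X → (∀ i, g x i ≤ 0) → (∀ j, h x j = 0) →
      (J.filter fun j => x j ≠ 0).card ≤ r → ‖x - xs‖ < ε → f xs ≤ f x)
    -- J* ⊆ J with |J*| = r and x*_j = 0 for j ∈ J \ J*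
    (Jstar : Finset (Fin n)) (hJsub : Jstar ⊆ J) (hJcard : Jstar.card = r)
    (hJzero : ∀ j ∈ J \ Jstar, xs j = 0)
    -- Robinson's condition at x* relative to J̄* = J \ J*
    (hRobinson : ∀ (a : Fin m → ℝ) (b : Fin p → ℝ) (c : Fin n → ℝ),
      ∃ d ∈ closure {d : Fin n → ℝ | ∃ t : ℝ, 0 ≤ t ∧ ∃ x ∈ X, d = t • (x - xs)},
        ∃ v : Fin m → ℝ, (∀ i, g xs i = 0 → v i ≤ 0) ∧
          (∀ i, (∑ j, gJac i j * d j) - v i = a i) ∧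
          (∀ i, (∑ j, hJac i j * d j) = b i) ∧
          (∀ j ∈ J \ Jstar, d j = c j)) :
    ∃ (lam : Fin m → ℝ) (mu : Fin p → ℝ) (z : Fin n → ℝ),
      (∀ x ∈ X, ∑ j, (-(fgrad j) - (∑ i, lam i * gJac i j) - (∑ i, mu i * hJac i j) - z j)
          * (x j - xs j) ≤ 0) ∧
      (∀ i, 0 ≤ lam i ∧ lam i * g xs i = 0) ∧
      (∀ j, j ∉ J \ Jstar → z j = 0) := by
  obtain ⟨hxX, hxg, hxh, -⟩ := hfeas
  obtain ⟨ε, hε, hmin⟩ := hlocmin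
  have hlin : ∀ (w d : Fin n → ℝ),
      (∑ j, w j • (ContinuousLinearMap.proj j : (Fin n → ℝ) →L[ℝ] ℝ)) d = ∑ j, w j * d j := by
    intro w d
    simp
  -- adding `∑ (x j - xs j) ^ 2` makes the minimizer strict and does not change the gradient
  have hpertd : HasFDerivAt (fun x => f x + ∑ j, (x j - xs j) ^ 2)
      (∑ j, fgrad j • (ContinuousLinearMap.proj j : (Fin n → ℝ) →L[ℝ] ℝ)) xs := by
    have hsq : HasFDerivAt (fun x : Fin n → ℝ => ∑ j, (x j - xs j) ^ 2)
        (∑ _j : Fin n, (0 : (Fin n → ℝ) →L[ℝ] ℝ)) xs :=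
      HasFDerivAt.fun_sum fun j _ => by
        simpa using ((hasFDerivAt_apply (𝕜 := ℝ) j xs).sub_const (xs j)).pow 2
    rw [Finset.sum_const_zero] at hsq
    exact (hfd.fun_add hsq).congr_fderiv (add_zero _)
  obtain ⟨Λ, hΛ, hΛ0, hΛg, hvar⟩ := exists_fritzJohn (ι := Fin m)
    (κ := Fin p ⊕ {j // j ∈ J \ Jstar}) (f := fun x => f x + ∑ j, (x j - xs j) ^ 2)
    (g := fun i x => g x i) (h := Sum.elim (fun j x => h x j) (fun j x => x j.1))
    hXclosed hXconv (by fun_prop) hg (by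
      rintro (j | j)
      · exact hh j
      · simp only [Sum.elim_inr]
        fun_prop)
    hxX hxg (by
      rintro (j | j)
      · exact hxh j
      · exact hJzero j.1 j.2) hε (by
      intro x hx hgx hhx hxε hne
      have hle : f xs ≤ f x := by
        refine hmin x hx hgx (fun j => hhx (Sum.inl j)) ?_ hxε
        rw [← hJcard]
        refine Finset.card_le_card fun j hj => ?_
        rw [Finset.mem_filter] at hj
        by_contra hjs
        exact hj.2 (hhx (Sum.inr ⟨j, Finset.mem_sdiff.2 ⟨hj.1, hjs⟩⟩))
      have hpos : 0 < ∑ j, (x j - xs j) ^ 2 := by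
        obtain ⟨j, hj⟩ := Function.ne_iff.1 hne
        exact Finset.sum_pos' (fun _ _ => sq_nonneg _)
          ⟨j, Finset.mem_univ j, by have := sub_ne_zero.2 hj; positivity⟩
      simpa using add_lt_add_of_le_of_lt hle hpos)
  obtain ⟨l₀, lam, nu⟩ := Λ
  set z : Fin n → ℝ := fun j => if hj : j ∈ J \ Jstar then nu (Sum.inr ⟨j, hj⟩) else 0 with hz
  have hzsum : ∀ d : Fin n → ℝ, ∑ j, z j * d j = ∑ j : {j // j ∈ J \ Jstar},
      nu (Sum.inr j) * d j.1 := by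
    intro d
    rw [← Finset.sum_subset (Finset.subset_univ (J \ Jstar))
      (fun j _ hj => by simp only [hz, dif_neg hj, zero_mul]), ← Finset.sum_coe_sort]
    exact Finset.sum_congr rfl fun j _ => by simp only [hz, dif_pos j.2]
  set S : (Fin n → ℝ) → ℝ := fun d => l₀ * ∑ j, fgrad j * d j
    + ∑ i, lam i * ∑ j, gJac i j * d j + ∑ i, nu (Sum.inl i) * ∑ j, hJac i j * d j
    + ∑ j, z j * d j with hS
  have hSvar : ∀ x ∈ X, 0 ≤ S (x - xs) := by
    intro x hx
    convert hvar x hx using 1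
    have hproj : ∀ j : Fin n, HasFDerivAt (fun x : Fin n → ℝ => x j)
        (ContinuousLinearMap.proj j : (Fin n → ℝ) →L[ℝ] ℝ) xs := fun j => hasFDerivAt_apply j xs
    simp only [hS, hpertd.fderiv, fun i => (hgd i).fderiv, Fintype.sum_sum_type, Sum.elim_inl,
      Sum.elim_inr, fun i => (hhd i).fderiv, fun j => (hproj j).fderiv, hlin, hzsum,
      ContinuousLinearMap.proj_apply, add_assoc]
  have hStangent : ∀ d ∈ closure {d : Fin n → ℝ | ∃ t : ℝ, 0 ≤ t ∧ ∃ x ∈ X, d = t • (x - xs)},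
      0 ≤ S d := by
    have hclosed : IsClosed {d | 0 ≤ S d} :=
      isClosed_le continuous_const (by fun_prop)
    refine fun d hd => closure_minimal ?_ hclosed hd
    rintro _ ⟨t, ht, x, hx, rfl⟩
    have hsmul : S (t • (x - xs)) = t * S (x - xs) := by
      simp only [hS, Pi.smul_apply, smul_eq_mul, mul_add, Finset.mul_sum]
      simp only [mul_left_comm]
    simpa [hsmul] using mul_nonneg ht (hSvar x hx)
  have hl₀ : 0 < l₀ := by
    refine lt_of_le_of_ne hΛ0 fun h0 => hΛ ?_
    obtain ⟨d, hd, v, hv, ha, hb, hc⟩ := hRobinson (-lam) (fun i => -nu (Sum.inl i)) (-z)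
    have hlv : ∑ i, lam i * v i ≤ 0 := by
      refine Finset.sum_nonpos fun i _ => ?_
      rcases mul_eq_zero.1 (hΛg i).2 with hi | hi
      · simp only at hi
        simp [hi]
      · exact mul_nonpos_of_nonneg_of_nonpos (hΛg i).1 (hv i hi)
    have hSd : S d = ∑ i, lam i * v i - (∑ i, lam i ^ 2 + ∑ i, nu (Sum.inl i) ^ 2
        + ∑ j : {j // j ∈ J \ Jstar}, nu (Sum.inr j) ^ 2) := by
      have hzd : ∀ j : {j // j ∈ J \ Jstar}, d j.1 = -nu (Sum.inr j) := fun j => by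
        rw [hc j.1 j.2, Pi.neg_apply]
        simp only [hz, dif_pos j.2]
      have hgd' : ∀ i, ∑ j, gJac i j * d j = v i - lam i := fun i => by
        have := ha i
        rw [Pi.neg_apply] at this
        linarith
      simp only [hS, hzsum, hzd, hb, hgd', ← h0, mul_sub, Finset.sum_sub_distrib, mul_neg,
        Finset.sum_neg_distrib, pow_two]
      ring
    have hSd0 := hStangent d hd
    have h1 : 0 ≤ ∑ i, lam i ^ 2 := by positivity
    have h2 : 0 ≤ ∑ i, nu (Sum.inl i) ^ 2 := by positivity
    have h3 : 0 ≤ ∑ j : {j // j ∈ J \ Jstar}, nu (Sum.inr j) ^ 2 := by positivity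
    have e1 : ∑ i, lam i ^ 2 = 0 := by linarith
    have e2 : ∑ i, nu (Sum.inl i) ^ 2 = 0 := by linarith
    have e3 : ∑ j : {j // j ∈ J \ Jstar}, nu (Sum.inr j) ^ 2 = 0 := by linarith
    rw [Finset.sum_eq_zero_iff_of_nonneg fun _ _ => sq_nonneg _] at e1 e2 e3
    refine Prod.ext h0.symm (Prod.ext (funext fun i => ?_) (funext fun j => ?_))
    · simpa using e1 i (Finset.mem_univ i)
    · rcases j with j | j
      · simpa using e2 j (Finset.mem_univ j)
      · simpa using e3 j (Finset.mem_univ j)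
  refine ⟨fun i => l₀⁻¹ * lam i, fun i => l₀⁻¹ * nu (Sum.inl i), fun j => l₀⁻¹ * z j,
    fun x hx => ?_, fun i => ⟨mul_nonneg (by positivity) (hΛg i).1, ?_⟩, fun j hj => ?_⟩
  · have hscaled : ∑ j, (-(fgrad j) - (∑ i, l₀⁻¹ * lam i * gJac i j)
        - (∑ i, l₀⁻¹ * nu (Sum.inl i) * hJac i j) - l₀⁻¹ * z j) * (x j - xs j)
        = -(l₀⁻¹ * S (x - xs)) := by
      simp only [hS, sub_mul, neg_mul, Finset.sum_sub_distrib, Finset.sum_neg_distrib, mul_add,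
        inv_mul_cancel_left₀ hl₀.ne', Finset.mul_sum, Finset.sum_mul, Pi.sub_apply]
      rw [Finset.sum_comm (γ := Fin m), Finset.sum_comm (γ := Fin p)]
      simp only [mul_assoc]
      ring
    rw [hscaled]
    exact neg_nonpos.2 (mul_nonneg (by positivity) (hSvar x hx))
  · rw [mul_assoc, (hΛg i).2, mul_zero]
  · simp only [hz, dif_neg hj, mul_zero]
end

section
/- Assume each component h_j of h is an affine function and that f and each component g_i of g are convex. Let x* be a feasible point of the problem (P1): minimize f(x) over x in X subject to g(x) ≤ 0 componentwise, h(x) = 0, and ‖x_J‖₀ ≤ r. Let 𝒥* = {J* ⊆ J : |J*| = r and x*_j = 0 for all j ∈ J \ J*}. Suppose that for every J* in 𝒥* there exists (λ*, μ*, z*) in ℝ^m × ℝ^p × ℝ^n such that: (i) −∇f(x*) − Σ_i λ*_i ∇g_i(x*) − Σ_j μ*_j ∇h_j(x*) − z* lies in the normal cone N_X(x*); (ii) λ*_i ≥ 0 and λ*_i g_i(x*) = 0 for i = 1, …, m; and (iii) z*_j = 0 for every j in the complement of J in {1, …, n} and every j in J*. Then x* is a local minimizer of (P1). -/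
open Finset

/-- The gradient inequality: a convex function lies above its tangent hyperplanes. -/
theorem ConvexOn.add_fderiv_le {E : Type*} [NormedAddCommGroup E] [NormedSpace ℝ E]
    {f : E → ℝ} {f' : E →L[ℝ] ℝ} {x : E} (hf : ConvexOn ℝ Set.univ f)
    (hd : HasFDerivAt f f' x) (y : E) : f x + f' (y - x) ≤ f y := by
  have hline : HasDerivAt (fun t : ℝ => f (AffineMap.lineMap x y t)) (f' (y - x)) 0 := by
    refine HasFDerivAt.comp_hasDerivAt (0 : ℝ) ?_ AffineMap.hasDerivAt_lineMap
    simpa using hd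
  have hconv : ConvexOn ℝ Set.univ (fun t : ℝ => f (AffineMap.lineMap x y t)) := by
    simpa [Function.comp_def] using hf.comp_affineMap (AffineMap.lineMap x y : ℝ →ᵃ[ℝ] E)
  have := hconv.le_slope_of_hasDerivAt (Set.mem_univ _) (Set.mem_univ _) zero_lt_one hline
  simp only [slope_def_field, AffineMap.lineMap_apply_one, AffineMap.lineMap_apply_zero, sub_zero,
    div_one] at this
  linarith

/-- Nonzero coordinates stay nonzero in a small enough neighbourhood. -/
theorem exists_pos_forall_norm_sub_lt_ne_zero {n : ℕ} (x₀ : Fin n → ℝ) :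
    ∃ ε > 0, ∀ x : Fin n → ℝ, ‖x - x₀‖ < ε → ∀ j, x₀ j ≠ 0 → x j ≠ 0 := by
  have hev : ∀ᶠ x in nhds x₀, ∀ j, x₀ j ≠ 0 → x j ≠ 0 := by
    rw [Filter.eventually_all]
    intro j
    by_cases hj : x₀ j = 0
    · simp [hj]
    · filter_upwards [(continuous_apply j).continuousAt.eventually_ne hj] with x hx _ using hx
  obtain ⟨ε, hε, hball⟩ := Metric.eventually_nhds_iff.1 hev
  exact ⟨ε, hε, fun x hx => hball (by rwa [dist_eq_norm])⟩

/-- First-order sufficient optimality conditions for the cardinality-constrained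
problem (P1) when the `l0` part is the only nonconvex part. -/
theorem first_order_sufficient_P1
    {n m p : ℕ} (X : Set (Fin n → ℝ)) (hXclosed : IsClosed X) (hXconv : Convex ℝ X)
    (f : (Fin n → ℝ) → ℝ) (g : (Fin n → ℝ) → Fin m → ℝ) (h : (Fin n → ℝ) → Fin p → ℝ)
    (hf : ContDiff ℝ 1 f) (hg : ∀ i, ContDiff ℝ 1 fun x => g x i)
    (hh : ∀ j, ContDiff ℝ 1 fun x => h x j)
    -- h affine, f and g convex
    (hhaff : ∀ j, ∃ (w : Fin n → ℝ) (b : ℝ), ∀ x, h x j = (∑ i, w i * x i) + b)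
    (hfconv : ConvexOn ℝ Set.univ f) (hgconv : ∀ i, ConvexOn ℝ Set.univ fun x => g x i)
    (J : Finset (Fin n)) (r : ℕ) (hr : r ≤ J.card)
    (xs : Fin n → ℝ)
    -- gradients of f, g, h at x*
    (fgrad : Fin n → ℝ) (gJac : Fin m → Fin n → ℝ) (hJac : Fin p → Fin n → ℝ)
    (hfd : HasFDerivAt f (∑ j, fgrad j • (ContinuousLinearMap.proj j : (Fin n → ℝ) →L[ℝ] ℝ)) xs)
    (hgd : ∀ i, HasFDerivAt (fun x => g x i)
      (∑ j, gJac i j • (ContinuousLinearMap.proj j : (Fin n → ℝ) →L[ℝ] ℝ)) xs)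
    (hhd : ∀ i, HasFDerivAt (fun x => h x i)
      (∑ j, hJac i j • (ContinuousLinearMap.proj j : (Fin n → ℝ) →L[ℝ] ℝ)) xs)
    -- x* is a feasible point of (P1)
    (hfeas : xs ∈ X ∧ (∀ i, g xs i ≤ 0) ∧ (∀ j, h xs j = 0) ∧
      (J.filter fun j => xs j ≠ 0).card ≤ r)
    -- for every J* ∈ 𝒥* there exist multipliers satisfying the KKT conditions
    (hKKT : ∀ Jstar : Finset (Fin n), Jstar ⊆ J → Jstar.card = r →
      (∀ j ∈ J \ Jstar, xs j = 0) →
      ∃ (lam : Fin m → ℝ) (mu : Fin p → ℝ) (z : Fin n → ℝ),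
        (∀ x ∈ X, ∑ j, (-(fgrad j) - (∑ i, lam i * gJac i j) - (∑ i, mu i * hJac i j) - z j)
            * (x j - xs j) ≤ 0) ∧
        (∀ i, 0 ≤ lam i ∧ lam i * g xs i = 0) ∧
        (∀ j, j ∉ J \ Jstar → z j = 0)) :
    -- then x* is a local minimizer of (P1)
    ∃ ε > 0, ∀ x, x ∈ X → (∀ i, g x i ≤ 0) → (∀ j, h x j = 0) →
      (J.filter fun j => x j ≠ 0).card ≤ r → ‖x - xs‖ < ε → f xs ≤ f x := by
  obtain ⟨hxs, -, hhs, -⟩ := hfeas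
  obtain ⟨ε, hε, hnz⟩ := exists_pos_forall_norm_sub_lt_ne_zero xs
  refine ⟨ε, hε, fun x hx hgx hhx hcard hdist => ?_⟩
  obtain ⟨S, hsupp, hSJ, hS⟩ := exists_subsuperset_card_eq (filter_subset _ J) hcard hr
  have hx0 : ∀ j ∈ J \ S, x j = 0 := fun j hj => by
    by_contra hne
    exact (mem_sdiff.1 hj).2 (hsupp (mem_filter.2 ⟨(mem_sdiff.1 hj).1, hne⟩))
  have hxs0 : ∀ j ∈ J \ S, xs j = 0 := fun j hj => by
    by_contra hne
    exact hnz x hdist j hne (hx0 j hj)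
  obtain ⟨lam, mu, z, hnormal, hlam, hz⟩ := hKKT S hSJ hS hxs0
  have hfx : f xs + ∑ j, fgrad j * (x j - xs j) ≤ f x := by
    simpa using hfconv.add_fderiv_le hfd x
  have hgl : ∀ i, lam i * ∑ j, gJac i j * (x j - xs j) ≤ 0 := fun i => by
    have hgi : g xs i + ∑ j, gJac i j * (x j - xs j) ≤ g x i := by
      simpa using (hgconv i).add_fderiv_le (hgd i) x
    have hmul := mul_le_mul_of_nonneg_left (hgi.trans (hgx i)) (hlam i).1
    rw [mul_add, (hlam i).2] at hmul
    simpa using hmul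
  have hhl : ∀ i, ∑ j, hJac i j * (x j - xs j) = 0 := fun i => by
    obtain ⟨w, b, hw⟩ := hhaff i
    have hcomb : ∀ (u v : Fin n → ℝ) (s t : ℝ), s + t = 1 →
        h (s • u + t • v) i = s * h u i + t * h v i := fun u v s t hst => by
      simp only [hw, Pi.add_apply, Pi.smul_apply, smul_eq_mul, mul_add, sum_add_distrib,
        mul_sum, mul_left_comm]
      linear_combination (-b) * hst
    have hconv : ConvexOn ℝ Set.univ fun x => h x i :=
      ⟨convex_univ, fun u _ v _ s t _ _ hst => (hcomb u v s t hst).le⟩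
    have hconc : ConcaveOn ℝ Set.univ fun x => h x i :=
      ⟨convex_univ, fun u _ v _ s t _ _ hst => (hcomb u v s t hst).ge⟩
    have hle := hconv.add_fderiv_le (hhd i) x
    have hge := hconc.neg.add_fderiv_le (hhd i).neg x
    simp [hhs, hhx] at hle hge
    exact le_antisymm hle hge
  have hzl : ∑ j, z j * (x j - xs j) = 0 := sum_eq_zero fun j _ => by
    by_cases hj : j ∈ J \ S
    · simp [hx0 j hj, hxs0 j hj]
    · simp [hz j hj]
  have hswap : ∀ {k : ℕ} (c : Fin k → ℝ) (A : Fin k → Fin n → ℝ),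
      ∑ j, (∑ i, c i * A i j) * (x j - xs j) = ∑ i, c i * ∑ j, A i j * (x j - xs j) := by
    intro k c A
    simp only [sum_mul, mul_sum, mul_assoc]
    exact sum_comm
  have hmain := hnormal x hx
  simp only [sub_mul, neg_mul, sum_sub_distrib, sum_neg_distrib, hswap, hhl, hzl, mul_zero,
    sum_const_zero] at hmain
  have hgsum := sum_nonpos fun i (_ : i ∈ univ) => hgl i
  linarith
end

section
/- For i = 1, …, n let X_i ⊆ ℝ with 0 ∈ X_i and let φ_i : ℝ → ℝ, and let r be a positive integer with r ≤ n. For each i, let x̃*_i be a minimizer of φ_i over X_i (i.e., x̃*_i ∈ X_i and φ_i(x̃*_i) ≤ φ_i(t) for all t ∈ X_i), and set v*_i = φ_i(0) − φ_i(x̃*_i). Let I* ⊆ {1, …, n} be an index set with |I*| = r corresponding to r largest values of {v*_i}, i.e., v*_i ≥ v*_j whenever i ∈ I* and j ∉ I*. Define x* ∈ ℝⁿ by x*_i = x̃*_i for i ∈ I* and x*_i = 0 otherwise. Then x* is an optimal solution of the problem: minimize Σ_{i=1}^n φ_i(x_i) subject to ‖x‖₀ ≤ r and x_i ∈ X_i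 for all i; that is, x* is feasible and Σ_i φ_i(x*_i) ≤ Σ_i φ_i(x_i) for every x with ‖x‖₀ ≤ r and x_i ∈ X_i for all i. -/
open Finset

/-- A finset holding the largest values of a nonnegative function has the largest sum among
all finsets of at most its cardinality. -/
theorem sum_le_sum_of_card_le_of_largest {ι : Type*} [DecidableEq ι] {v : ι → ℝ}
    (hv : ∀ i, 0 ≤ v i) {S T : Finset ι} (hcard : S.card ≤ T.card)
    (hT : ∀ i ∈ T, ∀ j ∉ T, v j ≤ v i) : ∑ i ∈ S, v i ≤ ∑ i ∈ T, v i := by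
  suffices h : ∑ i ∈ S \ T, v i ≤ ∑ i ∈ T \ S, v i by
    have h₁ := Finset.sum_inter_add_sum_sdiff S T v
    have h₂ := Finset.sum_inter_add_sum_sdiff T S v
    rw [Finset.inter_comm] at h₂
    linarith
  rcases (S \ T).eq_empty_or_nonempty with he | hne
  · rw [he, Finset.sum_empty]
    exact Finset.sum_nonneg fun i _ => hv i
  · obtain ⟨m, hm, hmax⟩ := Finset.exists_max_image (S \ T) v hne
    have hc : (S \ T).card ≤ (T \ S).card := Finset.card_sdiff_le_card_sdiff_iff.2 hcard
    calc ∑ i ∈ S \ T, v i ≤ (S \ T).card • v m := Finset.sum_le_card_nsmul _ _ _ hmax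
      _ ≤ (T \ S).card • v m := nsmul_le_nsmul_left (hv m) hc
      _ ≤ ∑ i ∈ T \ S, v i := Finset.card_nsmul_le_sum _ _ _ fun i hi =>
          hT i (Finset.mem_sdiff.1 hi).1 m (Finset.mem_sdiff.1 hm).2

/-- Closed-form solution of the separable cardinality-constrained problem:
`min Σ φ_i(x_i)` s.t. `‖x‖₀ ≤ r`, `x_i ∈ X_i`. -/
theorem special_l0_cardinality_constrained
    {n : ℕ} (Xi : Fin n → Set ℝ) (h0 : ∀ i, (0 : ℝ) ∈ Xi i)
    (φ : Fin n → ℝ → ℝ) (r : ℕ) (hr0 : 0 < r) (hrn : r ≤ n)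
    -- x̃*_i minimizes φ_i over X_i
    (xt : Fin n → ℝ) (hxt : ∀ i, xt i ∈ Xi i ∧ ∀ t ∈ Xi i, φ i (xt i) ≤ φ i t)
    -- I* is an index set of r largest values of v*_i = φ_i(0) − φ_i(x̃*_i)
    (Istar : Finset (Fin n)) (hIcard : Istar.card = r)
    (hIlargest : ∀ i ∈ Istar, ∀ j ∉ Istar, φ j 0 - φ j (xt j) ≤ φ i 0 - φ i (xt i))
    -- x* equals x̃* on I* and 0 elsewhere
    (xstar : Fin n → ℝ) (hxstar : ∀ i, xstar i = if i ∈ Istar then xt i else 0) :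
    -- then x* is an optimal solution
    ((univ.filter fun i => xstar i ≠ 0).card ≤ r ∧ (∀ i, xstar i ∈ Xi i)) ∧
    ∀ x : Fin n → ℝ, (univ.filter fun i => x i ≠ 0).card ≤ r → (∀ i, x i ∈ Xi i) →
      ∑ i, φ i (xstar i) ≤ ∑ i, φ i (x i) := by
  have hv : ∀ i, 0 ≤ φ i 0 - φ i (xt i) := fun i => sub_nonneg.2 ((hxt i).2 0 (h0 i))
  refine ⟨⟨?_, fun i => ?_⟩, fun x hx hxX => ?_⟩
  · rw [← hIcard]
    refine Finset.card_le_card fun i hi => ?_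
    by_contra h
    simp [hxstar, h] at hi
  · rw [hxstar]
    split_ifs
    exacts [(hxt i).1, h0 i]
  · have hsum := sum_le_sum_of_card_le_of_largest hv (hx.trans hIcard.ge) hIlargest
    have hstar : ∑ i, φ i (xstar i) =
        ∑ i, φ i 0 - ∑ i ∈ Istar, (φ i 0 - φ i (xt i)) := by
      rw [← Finset.sum_ite_mem_eq Istar, ← Finset.sum_sub_distrib]
      refine Finset.sum_congr rfl fun i _ => ?_
      rw [hxstar]
      split_ifs <;> ring
    have hlower : ∑ i, φ i 0 - ∑ i with x i ≠ 0, (φ i 0 - φ i (xt i)) ≤ ∑ i, φ i (x i) := by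
      rw [Finset.sum_filter, ← Finset.sum_sub_distrib]
      refine Finset.sum_le_sum fun i _ => ?_
      split_ifs with h
      · linarith [(hxt i).2 (x i) (hxX i)]
      · rw [not_not.1 h, sub_zero]
    linarith
end

section
/- For i = 1, …, n let X_i ⊆ ℝ with 0 ∈ X_i and let φ_i : ℝ → ℝ, and let ν ≥ 0. For each i, let x̃*_i be a minimizer of φ_i over X_i (i.e., x̃*_i ∈ X_i and φ_i(x̃*_i) ≤ φ_i(t) for all t ∈ X_i), and set v*_i = φ_i(0) − ν − φ_i(x̃*_i). Define x* ∈ ℝⁿ by x*_i = x̃*_i if v*_i ≥ 0 and x*_i = 0 otherwise. Then x* is an optimal solution of the problem: minimize ν‖x‖₀ + Σ_{i=1}^n φ_i(x_i) subject to x_i ∈ X_i for all i; that is, x* is feasible and ν‖x*‖₀ + Σ_i φ_i(x*_i) ≤ ν‖x‖₀ + Σ_i φ_i(x_i) for every x with x_i ∈ X_i for all i. -/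
open Finset

/-- Closed-form solution of the separable cardinality-penalized problem:
`min ν‖x‖₀ + Σ φ_i(x_i)` s.t. `x_i ∈ X_i`. -/
theorem special_l0_cardinality_penalized
    {n : ℕ} (Xi : Fin n → Set ℝ) (h0 : ∀ i, (0 : ℝ) ∈ Xi i)
    (φ : Fin n → ℝ → ℝ) (ν : ℝ) (hν : 0 ≤ ν)
    -- x̃*_i minimizes φ_i over X_i
    (xt : Fin n → ℝ) (hxt : ∀ i, xt i ∈ Xi i ∧ ∀ t ∈ Xi i, φ i (xt i) ≤ φ i t)
    -- v*_i = φ_i(0) − ν − φ_i(x̃*_i); x*_i = x̃*_i if v*_i ≥ 0, else 0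
    (xstar : Fin n → ℝ)
    (hxstar : ∀ i, xstar i = if 0 ≤ φ i 0 - ν - φ i (xt i) then xt i else 0) :
    -- then x* is an optimal solution
    (∀ i, xstar i ∈ Xi i) ∧
    ∀ x : Fin n → ℝ, (∀ i, x i ∈ Xi i) →
      ν * ((univ.filter fun i => xstar i ≠ 0).card : ℝ) + ∑ i, φ i (xstar i) ≤
        ν * ((univ.filter fun i => x i ≠ 0).card : ℝ) + ∑ i, φ i (x i) := by
  refine ⟨fun i => ?_, fun x hx => ?_⟩
  · rw [hxstar i]
    split_ifs
    exacts [(hxt i).1, h0 i]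
  · have objective_eq_sum (y : Fin n → ℝ) :
        ν * ((univ.filter fun i => y i ≠ 0).card : ℝ) + ∑ i, φ i (y i) =
          ∑ i, ((if y i ≠ 0 then ν else 0) + φ i (y i)) := by
      rw [sum_add_distrib, ← sum_filter, sum_const, nsmul_eq_mul, mul_comm]
    rw [objective_eq_sum, objective_eq_sum]
    refine sum_le_sum fun i _ => ?_
    have hmin := (hxt i).2 (x i) (hx i)
    rw [hxstar i]
    by_cases hv : 0 ≤ φ i 0 - ν - φ i (xt i)
    · rw [if_pos hv]
      by_cases hxi : x i = 0
      · rw [hxi] at hmin ⊢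
        rw [if_neg (not_not.mpr rfl : ¬(0 : ℝ) ≠ 0)]
        split_ifs <;> linarith
      · rw [if_pos hxi]
        split_ifs <;> linarith
    · rw [if_neg hv]
      by_cases hxi : x i = 0
      · rw [hxi]
      · rw [if_pos hxi, if_neg (not_not.mpr rfl)]
        linarith
end

section
/- Assume each component h_j of h is an affine function and that f and each component g_i of g are convex. Suppose (x*, y*) ∈ ℝⁿ × ℝ^J is a saddle point of the penalty function q_ρ over X × Y, that is, x* ∈ X minimizes q_ρ(·, y*) over X and y* ∈ Y minimizes q_ρ(x*, ·) over Y. Then (x*, y*) is a local minimizer of q_ρ over X × Y: there exists ε > 0 such that q_ρ(x, y) ≥ q_ρ(x*, y*) for all (x, y) ∈ X × Y with ‖(x, y) − (x*, y*)‖ < ε. -/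
open Finset

/-- The quadratic penalty function `q_ρ(x,y) = f(x) + (ρ/2)(‖max(g(x),0)‖² + ‖h(x)‖²
+ ‖x_J − y‖²)` associated with problem (P1). -/
noncomputable def qPen {n m p : ℕ} (J : Finset (Fin n))
    (f : (Fin n → ℝ) → ℝ) (g : (Fin n → ℝ) → Fin m → ℝ) (h : (Fin n → ℝ) → Fin p → ℝ)
    (ρ : ℝ) (x : Fin n → ℝ) (y : {j // j ∈ J} → ℝ) : ℝ :=
  f x + ρ / 2 * ((∑ i, max (g x i) 0 ^ 2) + (∑ j, h x j ^ 2) +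
    ∑ j : {j // j ∈ J}, (x j.1 - y j) ^ 2)

/-- The square of a real function preserving affine combinations is convex. -/
theorem convexOn_sq_of_affine {E : Type*} [AddCommGroup E] [Module ℝ E] (l : E → ℝ)
    (hl : ∀ u v : E, ∀ a b : ℝ, a + b = 1 → l (a • u + b • v) = a * l u + b * l v) :
    ConvexOn ℝ Set.univ fun u => l u ^ 2 := by
  refine ⟨convex_univ, fun u _ v _ a b ha hb hab => ?_⟩
  have key := (even_two.convexOn_pow (𝕜 := ℝ)).2 (Set.mem_univ (l u)) (Set.mem_univ (l v)) ha hb hab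
  simpa [hl u v a b hab] using key

/-- A finite sum of convex functions is convex. -/
theorem convexOn_univ_sum {E ι : Type*} [AddCommGroup E] [Module ℝ E] (s : Finset ι)
    {F : ι → E → ℝ} (hF : ∀ i, ConvexOn ℝ Set.univ (F i)) :
    ConvexOn ℝ Set.univ fun u => ∑ i ∈ s, F i u := by
  classical
  induction s using Finset.induction_on with
  | empty => simpa using convexOn_const (0 : ℝ) convex_univ
  | insert i s hi ih =>
    simp only [Finset.sum_insert hi]
    exact (hF i).add ih

/-- The penalty function is jointly convex when `f`, `g` are convex and `h` is affine. -/
theorem convexOn_qPen {n m p : ℕ} (J : Finset (Fin n))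
    {f : (Fin n → ℝ) → ℝ} {g : (Fin n → ℝ) → Fin m → ℝ} {h : (Fin n → ℝ) → Fin p → ℝ}
    (hhaff : ∀ j, ∃ (w : Fin n → ℝ) (b : ℝ), ∀ x, h x j = (∑ i, w i * x i) + b)
    (hf : ConvexOn ℝ Set.univ f) (hg : ∀ i, ConvexOn ℝ Set.univ fun x => g x i)
    {ρ : ℝ} (hρ : 0 ≤ ρ) :
    ConvexOn ℝ Set.univ fun z : (Fin n → ℝ) × ({j // j ∈ J} → ℝ) =>
      qPen J f g h ρ z.1 z.2 := by
  have hf' := hf.comp_linearMap (LinearMap.fst ℝ (Fin n → ℝ) ({j // j ∈ J} → ℝ))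
  have hg' : ∀ i, ConvexOn ℝ Set.univ
      fun z : (Fin n → ℝ) × ({j // j ∈ J} → ℝ) => max (g z.1 i) 0 ^ 2 := fun i =>
    (((hg i).comp_linearMap (LinearMap.fst ℝ (Fin n → ℝ) ({j // j ∈ J} → ℝ))).sup
      (convexOn_const (0 : ℝ) convex_univ)).pow (fun _ _ => le_max_right _ _) 2
  have hh' : ∀ j, ConvexOn ℝ Set.univ
      fun z : (Fin n → ℝ) × ({j // j ∈ J} → ℝ) => h z.1 j ^ 2 := by
    intro j
    obtain ⟨w, c, hw⟩ := hhaff j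
    refine convexOn_sq_of_affine _ fun u v a b hab => ?_
    have hsum : ∑ i, w i * (a * u.1 i + b * v.1 i)
        = a * ∑ i, w i * u.1 i + b * ∑ i, w i * v.1 i := by
      rw [Finset.mul_sum, Finset.mul_sum, ← Finset.sum_add_distrib]
      exact Finset.sum_congr rfl fun i _ => by ring
    simp only [hw, Prod.fst_add, Prod.smul_fst, Pi.add_apply, Pi.smul_apply, smul_eq_mul, hsum]
    linear_combination (-c) * hab
  have hd : ∀ j : {j // j ∈ J}, ConvexOn ℝ Set.univ
      fun z : (Fin n → ℝ) × ({j // j ∈ J} → ℝ) => (z.1 j.1 - z.2 j) ^ 2 := by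
    refine fun j => convexOn_sq_of_affine _ fun u v a b _ => ?_
    simp only [Prod.fst_add, Prod.smul_fst, Prod.snd_add, Prod.smul_snd, Pi.add_apply,
      Pi.smul_apply, smul_eq_mul]
    ring
  exact hf'.add ((((convexOn_univ_sum univ hg').add (convexOn_univ_sum univ hh')).add
    (convexOn_univ_sum univ hd)).smul (by positivity : 0 ≤ ρ / 2))

/-- If replacing the coordinate `y j` by `x j` does not decrease the penalty function, then
`x j = y j`. -/
theorem eq_of_qPen_le_update {n m p : ℕ} {J : Finset (Fin n)}
    {f : (Fin n → ℝ) → ℝ} {g : (Fin n → ℝ) → Fin m → ℝ} {h : (Fin n → ℝ) → Fin p → ℝ}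
    {ρ : ℝ} (hρ : 0 < ρ) {x : Fin n → ℝ} {y : {j // j ∈ J} → ℝ} {j : {j // j ∈ J}}
    (hle : qPen J f g h ρ x y ≤ qPen J f g h ρ x (Function.update y j (x j.1))) :
    x j.1 = y j := by
  have hsum : ∑ i : {j // j ∈ J}, (x i.1 - y i) ^ 2
      ≤ ∑ i : {j // j ∈ J}, (x i.1 - Function.update y j (x j.1) i) ^ 2 := by
    unfold qPen at hle
    have h' := le_of_mul_le_mul_left (le_of_add_le_add_left hle) (by positivity : 0 < ρ / 2)
    exact le_of_add_le_add_left h'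
  rw [← Finset.add_sum_erase _ _ (Finset.mem_univ j),
    ← Finset.add_sum_erase _ _ (Finset.mem_univ j)] at hsum
  have herase : ∑ i ∈ univ.erase j, (x i.1 - Function.update y j (x j.1) i) ^ 2
      = ∑ i ∈ univ.erase j, (x i.1 - y i) ^ 2 :=
    Finset.sum_congr rfl fun i hi => by rw [Function.update_of_ne (Finset.ne_of_mem_erase hi)]
  rw [herase, Function.update_self] at hsum
  have hsq : (x j.1 - y j) ^ 2 = 0 := le_antisymm (by linarith) (sq_nonneg _)
  exact sub_eq_zero.mp (pow_eq_zero_iff two_ne_zero |>.mp hsq)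

/-- At a sparse minimizer `ys` of the penalty function in `y`, the residual `xs - ys` vanishes
on every coordinate in which a sparse `y` with larger support differs from `ys`. -/
theorem residual_mul_sub_eq_zero {n m p : ℕ} {J : Finset (Fin n)} {r : ℕ}
    {f : (Fin n → ℝ) → ℝ} {g : (Fin n → ℝ) → Fin m → ℝ} {h : (Fin n → ℝ) → Fin p → ℝ}
    {ρ : ℝ} (hρ : 0 < ρ) {xs : Fin n → ℝ} {ys y : {j // j ∈ J} → ℝ}
    (hmin : ∀ y : {j // j ∈ J} → ℝ, (univ.filter fun j => y j ≠ 0).card ≤ r →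
      qPen J f g h ρ xs ys ≤ qPen J f g h ρ xs y)
    (hy : (univ.filter fun j => y j ≠ 0).card ≤ r)
    (hsupp : ∀ j, ys j ≠ 0 → y j ≠ 0) (j : {j // j ∈ J}) :
    (xs j.1 - ys j) * (y j - ys j) = 0 := by
  by_cases hyj : y j = 0
  · have : ys j = 0 := by
      by_contra hne
      exact hsupp j hne hyj
    simp [hyj, this]
  · have hcard : (univ.filter fun i => Function.update ys j (xs j.1) i ≠ 0).card ≤ r := by
      refine (Finset.card_le_card fun i hi => ?_).trans hy
      simp only [Finset.mem_filter, Finset.mem_univ, true_and] at hi ⊢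
      rcases eq_or_ne i j with rfl | hij
      · exact hyj
      · exact hsupp i (by rwa [Function.update_of_ne hij] at hi)
    rw [eq_of_qPen_le_update hρ (hmin _ hcard), sub_self, zero_mul]

/-- A real number bounded below by `t * C` for all small `t > 0` is nonnegative. -/
theorem nonneg_of_forall_mul_le {a C : ℝ} (H : ∀ t : ℝ, 0 < t → t ≤ 1 → t * C ≤ a) : 0 ≤ a := by
  have ht : Filter.Tendsto (fun t : ℝ => t * C) (nhdsWithin 0 (Set.Ioi 0)) (nhds 0) := by
    have hc : Continuous fun t : ℝ => t * C := by fun_prop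
    simpa using (hc.tendsto 0).mono_left nhdsWithin_le_nhds
  refine le_of_tendsto ht ?_
  filter_upwards [Ioc_mem_nhdsGT (zero_lt_one' ℝ)] with t ht
  exact H t ht.1 ht.2

/-- A saddle point of the penalty subproblem `min q_ρ(x,y)` over `X × Y` is a local
minimizer of it, provided `h` is affine and `f`, `g` are convex. -/
theorem saddle_point_is_local_min_qPen
    {n m p : ℕ} (X : Set (Fin n → ℝ)) (hXclosed : IsClosed X) (hXconv : Convex ℝ X)
    (f : (Fin n → ℝ) → ℝ) (g : (Fin n → ℝ) → Fin m → ℝ) (h : (Fin n → ℝ) → Fin p → ℝ)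
    (hf : ContDiff ℝ 1 f) (hg : ∀ i, ContDiff ℝ 1 fun x => g x i)
    (hh : ∀ j, ContDiff ℝ 1 fun x => h x j)
    -- h affine, f and g convex
    (hhaff : ∀ j, ∃ (w : Fin n → ℝ) (b : ℝ), ∀ x, h x j = (∑ i, w i * x i) + b)
    (hfconv : ConvexOn ℝ Set.univ f) (hgconv : ∀ i, ConvexOn ℝ Set.univ fun x => g x i)
    (J : Finset (Fin n)) (r : ℕ) (hr : r ≤ J.card) (ρ : ℝ) (hρ : 0 < ρ)
    (xs : Fin n → ℝ) (ys : {j // j ∈ J} → ℝ)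
    -- (x*, y*) is a saddle point of q_ρ over X × Y
    (hxs : xs ∈ X) (hys : (univ.filter fun j => ys j ≠ 0).card ≤ r)
    (hsadx : ∀ x ∈ X, qPen J f g h ρ xs ys ≤ qPen J f g h ρ x ys)
    (hsady : ∀ y : {j // j ∈ J} → ℝ, (univ.filter fun j => y j ≠ 0).card ≤ r →
      qPen J f g h ρ xs ys ≤ qPen J f g h ρ xs y) :
    -- then (x*, y*) is a local minimizer of q_ρ over X × Y
    ∃ ε > 0, ∀ x ∈ X, ∀ y : {j // j ∈ J} → ℝ, (univ.filter fun j => y j ≠ 0).card ≤ r →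
      ‖(x, y) - (xs, ys)‖ < ε → qPen J f g h ρ xs ys ≤ qPen J f g h ρ x y := by
  have hev : ∀ᶠ z : (Fin n → ℝ) × ({j // j ∈ J} → ℝ) in nhds (xs, ys),
      ∀ j, ys j ≠ 0 → z.2 j ≠ 0 := by
    refine Filter.eventually_all.2 fun j => ?_
    by_cases hj : ys j = 0
    · simp [hj]
    · have hc : Continuous fun z : (Fin n → ℝ) × ({j // j ∈ J} → ℝ) => z.2 j := by fun_prop
      filter_upwards [hc.continuousAt.eventually_ne (x := (xs, ys)) hj] with z hz _ using hz
  obtain ⟨ε, hε, hball⟩ := Metric.eventually_nhds_iff.1 hev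
  refine ⟨ε, hε, fun x hx y hy hxy => ?_⟩
  have horth := residual_mul_sub_eq_zero hρ hsady hy
    (hball (y := (x, y)) (by rwa [dist_eq_norm]))
  rw [← sub_nonneg]
  refine nonneg_of_forall_mul_le
    (C := ρ / 2 * ∑ j : {j // j ∈ J}, ((y j - ys j) ^ 2 - 2 * (y j - ys j) * (x j.1 - xs j.1)))
    fun t ht ht1 => ?_
  have hconv := (convexOn_qPen J hhaff hfconv hgconv hρ.le).2 (Set.mem_univ (xs, ys))
    (Set.mem_univ (x, y)) (sub_nonneg.2 ht1) ht.le (sub_add_cancel 1 t)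
  have hmin := hsadx _ (hXconv hxs hx (sub_nonneg.2 ht1) ht.le (sub_add_cancel 1 t))
  have hexp : qPen J f g h ρ ((1 - t) • xs + t • x) ((1 - t) • ys + t • y)
      = qPen J f g h ρ ((1 - t) • xs + t • x) ys + t ^ 2 * (ρ / 2 *
        ∑ j : {j // j ∈ J}, ((y j - ys j) ^ 2 - 2 * (y j - ys j) * (x j.1 - xs j.1))) := by
    have hsum : ∑ j : {j // j ∈ J}, (((1 - t) • xs + t • x) j.1 - ((1 - t) • ys + t • y) j) ^ 2
        = ∑ j : {j // j ∈ J}, (((1 - t) • xs + t • x) j.1 - ys j) ^ 2 + t ^ 2 *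
          ∑ j : {j // j ∈ J}, ((y j - ys j) ^ 2 - 2 * (y j - ys j) * (x j.1 - xs j.1)) := by
      rw [Finset.mul_sum, ← Finset.sum_add_distrib]
      refine Finset.sum_congr rfl fun j _ => ?_
      simp only [Pi.add_apply, Pi.smul_apply, smul_eq_mul]
      linear_combination (-2 * t) * horth j
    unfold qPen
    rw [hsum]
    ring
  simp only [Prod.smul_mk, Prod.mk_add_mk, smul_eq_mul] at hconv
  rw [hexp] at hconv
  refine le_of_mul_le_mul_left ?_ ht
  linarith
end

section
/- Assume f, g and h are continuous, and let ρ > 0. Let {(x^l, y^l)}_{l ≥ 0} be a sequence in X × Y generated by the block coordinate descent method: for each l, x^{l+1} minimizes q_ρ(·, y^l) over X and y^{l+1} minimizes q_ρ(x^{l+1}, ·) over Y. Suppose (x*, y*) is an accumulation point of {(x^l, y^l)} (the limit of some subsequence). Then (x*, y*) is a saddle point of q_ρ over X × Y: x* ∈ X minimizes q_ρ(·, y*) over X, and y* ∈ Y minimizes q_ρ(x*, ·) over Y. -/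
open Finset Filter

theorem continuous_qPen {n m p : ℕ} (J : Finset (Fin n))
    {f : (Fin n → ℝ) → ℝ} {g : (Fin n → ℝ) → Fin m → ℝ} {h : (Fin n → ℝ) → Fin p → ℝ}
    (hf : Continuous f) (hg : Continuous g) (hh : Continuous h) (ρ : ℝ) :
    Continuous fun z : (Fin n → ℝ) × ({j // j ∈ J} → ℝ) => qPen J f g h ρ z.1 z.2 := by
  unfold qPen
  fun_prop

/-- The set of vectors with at most `r` nonzero entries is closed. -/
theorem isClosed_setOf_card_ne_zero_le {ι : Type*} [Fintype ι] (r : ℕ) :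
    IsClosed {y : ι → ℝ | (univ.filter fun j => y j ≠ 0).card ≤ r} := by
  rw [← isOpen_compl_iff, isOpen_iff_mem_nhds]
  intro y hy
  have hsupp : ∀ᶠ z in nhds y, ∀ j, y j ≠ 0 → z j ≠ 0 := by
    rw [eventually_all]
    intro j
    by_cases hj : y j = 0
    · simp [hj]
    · filter_upwards [(continuous_apply j).continuousAt.eventually_ne hj] with z hz _ using hz
  filter_upwards [hsupp] with z hz hzr
  exact hy ((card_le_card (monotone_filter_right _ fun j _ => hz j)).trans hzr)

/-- Every accumulation point of a block coordinate descent sequence for a continuous function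
over a product of closed sets is a saddle point. -/
theorem saddle_point_of_blockCoordinateDescent {E F : Type*} [TopologicalSpace E]
    [TopologicalSpace F] {q : E → F → ℝ} (hq : Continuous fun z : E × F => q z.1 z.2)
    {X : Set E} {Y : Set F} (hX : IsClosed X) (hY : IsClosed Y) {x : ℕ → E} {y : ℕ → F}
    (hxX : ∀ l, x l ∈ X) (hyY : ∀ l, y l ∈ Y)
    (hx : ∀ l, ∀ u ∈ X, q (x (l + 1)) (y l) ≤ q u (y l))
    (hy : ∀ l, ∀ v ∈ Y, q (x (l + 1)) (y (l + 1)) ≤ q (x (l + 1)) v)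
    {φ : ℕ → ℕ} (hφ : StrictMono φ) {a : E} {b : F}
    (hlim : Tendsto (fun l => (x (φ l), y (φ l))) atTop (nhds (a, b))) :
    (a ∈ X ∧ ∀ u ∈ X, q a b ≤ q u b) ∧ (b ∈ Y ∧ ∀ v ∈ Y, q a b ≤ q a v) := by
  have hxa : Tendsto (fun l => x (φ l)) atTop (nhds a) := (continuous_fst.tendsto _).comp hlim
  have hyb : Tendsto (fun l => y (φ l)) atTop (nhds b) := (continuous_snd.tendsto _).comp hlim
  have hqφ : Tendsto (fun l => q (x (φ l)) (y (φ l))) atTop (nhds (q a b)) :=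
    (hq.tendsto (a, b)).comp hlim
  have hanti : Antitone fun l => q (x l) (y l) :=
    antitone_nat_of_succ_le fun l => (hy l _ (hyY l)).trans (hx l _ (hxX l))
  have hge : ∀ l, q a b ≤ q (x l) (y l) := fun l =>
    le_of_tendsto hqφ <| (eventually_ge_atTop l).mono fun k hk =>
      hanti (hk.trans (hφ.id_le k))
  refine ⟨⟨hX.mem_of_tendsto hxa (.of_forall fun l => hxX _), fun u hu => ?_⟩,
    hY.mem_of_tendsto hyb (.of_forall fun l => hyY _), fun v hv => ?_⟩
  · have hlu : Tendsto (fun l => q u (y (φ l))) atTop (nhds (q u b)) :=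
      (hq.tendsto (u, b)).comp (tendsto_const_nhds.prodMk_nhds hyb)
    exact ge_of_tendsto hlu <| .of_forall fun l =>
      (hge (φ l + 1)).trans <| (hy _ _ (hyY _)).trans (hx _ u hu)
  · have hlv : Tendsto (fun l => q (x (φ l)) v) atTop (nhds (q a v)) :=
      (hq.tendsto (a, v)).comp (hxa.prodMk_nhds tendsto_const_nhds)
    refine le_of_tendsto_of_tendsto hqφ hlv ?_
    filter_upwards [hφ.tendsto_atTop.eventually_ge_atTop 1] with l hl
    obtain ⟨k, hk⟩ := Nat.exists_eq_add_of_le' hl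
    simpa only [hk] using hy k v hv

/-- Any accumulation point of the sequence generated by the block coordinate descent
method applied to `min q_ρ(x,y)` over `X × Y` is a saddle point of this problem. -/
theorem bcd_accumulation_point_is_saddle_point_qPen
    {n m p : ℕ} (X : Set (Fin n → ℝ)) (hXclosed : IsClosed X) (hXconv : Convex ℝ X)
    (f : (Fin n → ℝ) → ℝ) (g : (Fin n → ℝ) → Fin m → ℝ) (h : (Fin n → ℝ) → Fin p → ℝ)
    (hf : Continuous f) (hg : Continuous g) (hh : Continuous h)
    (J : Finset (Fin n)) (r : ℕ) (hr : r ≤ J.card) (ρ : ℝ) (hρ : 0 < ρ)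
    -- the BCD sequence
    (xseq : ℕ → Fin n → ℝ) (yseq : ℕ → {j // j ∈ J} → ℝ)
    (hmem : ∀ l, xseq l ∈ X ∧ (univ.filter fun j => yseq l j ≠ 0).card ≤ r)
    (hxstep : ∀ l, ∀ x ∈ X, qPen J f g h ρ (xseq (l + 1)) (yseq l) ≤ qPen J f g h ρ x (yseq l))
    (hystep : ∀ l, ∀ y : {j // j ∈ J} → ℝ, (univ.filter fun j => y j ≠ 0).card ≤ r →
      qPen J f g h ρ (xseq (l + 1)) (yseq (l + 1)) ≤ qPen J f g h ρ (xseq (l + 1)) y)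
    -- (x*, y*) is an accumulation point of the sequence
    (xs : Fin n → ℝ) (ys : {j // j ∈ J} → ℝ)
    (hacc : ∃ φ : ℕ → ℕ, StrictMono φ ∧
      Tendsto (fun l => (xseq (φ l), yseq (φ l))) atTop (nhds (xs, ys))) :
    -- then (x*, y*) is a saddle point of q_ρ over X × Y
    (xs ∈ X ∧ ∀ x ∈ X, qPen J f g h ρ xs ys ≤ qPen J f g h ρ x ys) ∧
    ((univ.filter fun j => ys j ≠ 0).card ≤ r ∧
      ∀ y : {j // j ∈ J} → ℝ, (univ.filter fun j => y j ≠ 0).card ≤ r →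
        qPen J f g h ρ xs ys ≤ qPen J f g h ρ xs y) := by
  obtain ⟨φ, hφ, hlim⟩ := hacc
  exact saddle_point_of_blockCoordinateDescent (continuous_qPen J hf hg hh ρ) hXclosed
    (isClosed_setOf_card_ne_zero_le r) (fun l => (hmem l).1) (fun l => (hmem l).2)
    hxstep hystep hφ hlim
end

section
/- Assume each component h_j of h is an affine function, f and each component g_i of g are convex and continuously differentiable, and let ρ > 0. Let {(x^l, y^l)}_{l ≥ 0} be a sequence in X × Y generated by the block coordinate descent method: for each l, x^{l+1} minimizes q_ρ(·, y^l) over X and y^{l+1} minimizes q_ρ(x^{l+1}, ·) over Y. Then any accumulation point (x*, y*) of {(x^l, y^l)} is a local minimizer of q_ρ over X × Y: there exists ε > 0 such that q_ρ(x, y) ≥ q_ρ(x*, y*) for all (x, y) ∈ X × Y with ‖(x, y) − (x*, y*)‖ < ε. -/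
open Finset Filter

/-- A real affine function of `t` that is nonnegative on `(0, 1]` is nonnegative at `0`. -/
lemma nonneg_of_forall_add_mul_nonneg {A B : ℝ} (hB : 0 ≤ B)
    (h : ∀ t : ℝ, 0 < t → t ≤ 1 → 0 ≤ A + t * B) : 0 ≤ A := by
  by_contra! hA
  have hBA : 0 < B - A := by linarith
  have key := h (-A / (B - A)) (div_pos (by linarith) hBA)
    ((div_le_one hBA).2 (by linarith))
  have heq : A + -A / (B - A) * B = -(A ^ 2 / (B - A)) := by
    field_simp
    ring
  have hpos : 0 < A ^ 2 / (B - A) := div_pos (by nlinarith) hBA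
  linarith

/-- First-order optimality for a convex function plus a weighted sum of squares. -/
lemma ConvexOn.variational_inequality_of_sum_sq {n : ℕ} {J : Finset (Fin n)}
    {X : Set (Fin n → ℝ)} (hX : Convex ℝ X) {F : (Fin n → ℝ) → ℝ} (hF : ConvexOn ℝ Set.univ F)
    {ρ : ℝ} (hρ : 0 < ρ) {xs : Fin n → ℝ} (hxs : xs ∈ X) {ys : {j // j ∈ J} → ℝ}
    (hmin : ∀ x ∈ X, F xs + ρ / 2 * ∑ j : {j // j ∈ J}, (xs j.1 - ys j) ^ 2 ≤
      F x + ρ / 2 * ∑ j : {j // j ∈ J}, (x j.1 - ys j) ^ 2)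
    {x : Fin n → ℝ} (hx : x ∈ X) :
    0 ≤ F x - F xs + ρ * ∑ j : {j // j ∈ J}, (xs j.1 - ys j) * (x j.1 - xs j.1) := by
  refine nonneg_of_forall_add_mul_nonneg
    (B := ρ / 2 * ∑ j : {j // j ∈ J}, (x j.1 - xs j.1) ^ 2) (by positivity) ?_
  intro t ht ht1
  have h1 := hmin _ (hX hxs hx (sub_nonneg.2 ht1) ht.le (by ring))
  have h2 := hF.2 (Set.mem_univ xs) (Set.mem_univ x) (sub_nonneg.2 ht1) ht.le (by ring)
  have h3 : ∑ j : {j // j ∈ J}, (((1 - t) • xs + t • x) j.1 - ys j) ^ 2 =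
      ∑ j : {j // j ∈ J}, (xs j.1 - ys j) ^ 2 +
      (2 * t) * ∑ j : {j // j ∈ J}, (xs j.1 - ys j) * (x j.1 - xs j.1) +
      t ^ 2 * ∑ j : {j // j ∈ J}, (x j.1 - xs j.1) ^ 2 := by
    rw [mul_sum, mul_sum, ← sum_add_distrib, ← sum_add_distrib]
    refine sum_congr rfl fun j _ => ?_
    simp only [Pi.add_apply, Pi.smul_apply, smul_eq_mul]
    ring
  rw [h3] at h1
  simp only [smul_eq_mul] at h2
  refine nonneg_of_mul_nonneg_right (a := t) ?_ ht
  nlinarith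

lemma convexOn_penalty {n m p : ℕ}
    {f : (Fin n → ℝ) → ℝ} {g : (Fin n → ℝ) → Fin m → ℝ} {h : (Fin n → ℝ) → Fin p → ℝ}
    (hhaff : ∀ j, ∃ (w : Fin n → ℝ) (b : ℝ), ∀ x, h x j = (∑ i, w i * x i) + b)
    (hfconv : ConvexOn ℝ Set.univ f) (hgconv : ∀ i, ConvexOn ℝ Set.univ fun x => g x i)
    {ρ : ℝ} (hρ : 0 < ρ) :
    ConvexOn ℝ Set.univ fun x =>
      f x + ρ / 2 * ((∑ i, max (g x i) 0 ^ 2) + ∑ j, h x j ^ 2) := by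
  have hg2 : ∀ i, ConvexOn ℝ Set.univ fun x => max (g x i) 0 ^ 2 := fun i =>
    ((hgconv i).sup (convexOn_const 0 convex_univ)).pow (fun _ _ => le_max_right _ _) 2
  have hh2 : ∀ j, ConvexOn ℝ Set.univ fun x => h x j ^ 2 := by
    intro j
    obtain ⟨w, b, hw⟩ := hhaff j
    refine ⟨convex_univ, fun x _ y _ s t hs ht hst => ?_⟩
    have haff : h (s • x + t • y) j = s * h x j + t * h y j := by
      simp only [hw, Pi.add_apply, Pi.smul_apply, smul_eq_mul, mul_add, sum_add_distrib,
        mul_sum, mul_left_comm]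
      linear_combination (-b) * hst
    have := (even_two.convexOn_pow (𝕜 := ℝ)).2 (Set.mem_univ (h x j)) (Set.mem_univ (h y j))
      hs ht hst
    simpa only [haff, smul_eq_mul] using this
  have hsum : ConvexOn ℝ Set.univ fun x => (∑ i, max (g x i) 0 ^ 2) + ∑ j, h x j ^ 2 := by
    refine ConvexOn.add ⟨convex_univ, fun x hx y hy s t hs ht hst => ?_⟩
      ⟨convex_univ, fun x hx y hy s t hs ht hst => ?_⟩
    · simp only [smul_eq_mul, mul_sum, ← sum_add_distrib]
      exact sum_le_sum fun i _ => (hg2 i).2 hx hy hs ht hst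
    · simp only [smul_eq_mul, mul_sum, ← sum_add_distrib]
      exact sum_le_sum fun j _ => (hh2 j).2 hx hy hs ht hst
  exact hfconv.add (hsum.smul (by positivity : 0 ≤ ρ / 2))

/-- If `ys` minimizes the penalty over `r`-sparse vectors, then it agrees with `xs` on the
support of every `r`-sparse `y` whose support contains that of `ys`. -/
lemma eq_of_minimizer_of_support_subset {n m p : ℕ} {J : Finset (Fin n)} {r : ℕ}
    {f : (Fin n → ℝ) → ℝ} {g : (Fin n → ℝ) → Fin m → ℝ} {h : (Fin n → ℝ) → Fin p → ℝ}
    {ρ : ℝ} (hρ : 0 < ρ) {xs : Fin n → ℝ} {ys y : {j // j ∈ J} → ℝ}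
    (hmin : ∀ y : {j // j ∈ J} → ℝ, (univ.filter fun j => y j ≠ 0).card ≤ r →
      qPen J f g h ρ xs ys ≤ qPen J f g h ρ xs y)
    (hy : (univ.filter fun j => y j ≠ 0).card ≤ r) (hsupp : ∀ j, ys j ≠ 0 → y j ≠ 0)
    {j : {j // j ∈ J}} (hj : y j ≠ 0) : xs j.1 = ys j := by
  have hcard : (univ.filter fun k => Function.update ys j (xs j.1) k ≠ 0).card ≤ r := by
    refine (card_le_card fun k hk => ?_).trans hy
    simp only [mem_filter, mem_univ, true_and] at hk ⊢
    by_cases hkj : k = j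
    · rwa [hkj]
    · rw [Function.update_of_ne hkj] at hk
      exact hsupp k hk
  have hle := hmin _ hcard
  have hsum : ∑ k : {j // j ∈ J}, (xs k.1 - ys k) ^ 2 ≤
      ∑ k : {j // j ∈ J}, (xs k.1 - Function.update ys j (xs j.1) k) ^ 2 := by
    unfold qPen at hle
    have := le_of_mul_le_mul_left (le_of_add_le_add_left hle) (half_pos hρ)
    linarith
  rw [← add_sum_erase _ _ (mem_univ j), ← add_sum_erase _ _ (mem_univ j),
    Function.update_self] at hsum
  have hrest : ∑ k ∈ univ.erase j, (xs k.1 - Function.update ys j (xs j.1) k) ^ 2 =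
      ∑ k ∈ univ.erase j, (xs k.1 - ys k) ^ 2 :=
    sum_congr rfl fun k hk => by rw [Function.update_of_ne (ne_of_mem_erase hk)]
  rw [hrest] at hsum
  have hsq : (xs j.1 - ys j) ^ 2 = 0 := le_antisymm (by linarith) (sq_nonneg _)
  exact sub_eq_zero.1 (pow_eq_zero_iff two_ne_zero |>.1 hsq)

/-- When `h` is affine and `f`, `g` are convex and continuously differentiable, any
accumulation point of the sequence generated by the block coordinate descent method for
`min q_ρ(x,y)` over `X × Y` is a local minimizer of this problem. -/
theorem bcd_accumulation_point_is_local_min_qPen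
    {n m p : ℕ} (X : Set (Fin n → ℝ)) (hXclosed : IsClosed X) (hXconv : Convex ℝ X)
    (f : (Fin n → ℝ) → ℝ) (g : (Fin n → ℝ) → Fin m → ℝ) (h : (Fin n → ℝ) → Fin p → ℝ)
    (hf : ContDiff ℝ 1 f) (hg : ∀ i, ContDiff ℝ 1 fun x => g x i)
    (hh : ∀ j, ContDiff ℝ 1 fun x => h x j)
    -- h affine, f and g convex
    (hhaff : ∀ j, ∃ (w : Fin n → ℝ) (b : ℝ), ∀ x, h x j = (∑ i, w i * x i) + b)
    (hfconv : ConvexOn ℝ Set.univ f) (hgconv : ∀ i, ConvexOn ℝ Set.univ fun x => g x i)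
    (J : Finset (Fin n)) (r : ℕ) (hr : r ≤ J.card) (ρ : ℝ) (hρ : 0 < ρ)
    -- the BCD sequence
    (xseq : ℕ → Fin n → ℝ) (yseq : ℕ → {j // j ∈ J} → ℝ)
    (hmem : ∀ l, xseq l ∈ X ∧ (univ.filter fun j => yseq l j ≠ 0).card ≤ r)
    (hxstep : ∀ l, ∀ x ∈ X, qPen J f g h ρ (xseq (l + 1)) (yseq l) ≤ qPen J f g h ρ x (yseq l))
    (hystep : ∀ l, ∀ y : {j // j ∈ J} → ℝ, (univ.filter fun j => y j ≠ 0).card ≤ r →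
      qPen J f g h ρ (xseq (l + 1)) (yseq (l + 1)) ≤ qPen J f g h ρ (xseq (l + 1)) y)
    -- (x*, y*) is an accumulation point of the sequence
    (xs : Fin n → ℝ) (ys : {j // j ∈ J} → ℝ)
    (hacc : ∃ φ : ℕ → ℕ, StrictMono φ ∧
      Tendsto (fun l => (xseq (φ l), yseq (φ l))) atTop (nhds (xs, ys))) :
    -- then (x*, y*) is a local minimizer of q_ρ over X × Y
    ∃ ε > 0, ∀ x ∈ X, ∀ y : {j // j ∈ J} → ℝ, (univ.filter fun j => y j ≠ 0).card ≤ r →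
      ‖(x, y) - (xs, ys)‖ < ε → qPen J f g h ρ xs ys ≤ qPen J f g h ρ x y := by
  obtain ⟨φ, hφ, hlim⟩ := hacc
  have hgc : ∀ i, Continuous fun x => g x i := fun i => (hg i).continuous
  have hhc : ∀ j, Continuous fun x => h x j := fun j => (hh j).continuous
  have hfc := hf.continuous
  have hqc : Continuous fun z : (Fin n → ℝ) × ({j // j ∈ J} → ℝ) => qPen J f g h ρ z.1 z.2 := by
    unfold qPen
    have h1 : ∀ i, Continuous fun z : (Fin n → ℝ) × ({j // j ∈ J} → ℝ) => g z.1 i :=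
      fun i => (hgc i).comp continuous_fst
    have h2 : ∀ j, Continuous fun z : (Fin n → ℝ) × ({j // j ∈ J} → ℝ) => h z.1 j :=
      fun j => (hhc j).comp continuous_fst
    fun_prop
  have hx_lim : Tendsto (fun l => xseq (φ l)) atTop (nhds xs) :=
    (continuous_fst.tendsto _).comp hlim
  have hy_lim : Tendsto (fun l => yseq (φ l)) atTop (nhds ys) :=
    (continuous_snd.tendsto _).comp hlim
  have hq_lim : Tendsto (fun l => qPen J f g h ρ (xseq (φ l)) (yseq (φ l))) atTop
      (nhds (qPen J f g h ρ xs ys)) := (hqc.tendsto (xs, ys)).comp hlim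
  have hanti : Antitone fun l => qPen J f g h ρ (xseq l) (yseq l) :=
    antitone_nat_of_succ_le fun l =>
      (hystep l _ (hmem l).2).trans (hxstep l _ (hmem l).1)
  have hxsX : xs ∈ X := hXclosed.mem_of_tendsto hx_lim (Eventually.of_forall fun l => (hmem _).1)
  have hlower : ∀ l, qPen J f g h ρ xs ys ≤ qPen J f g h ρ (xseq l) (yseq l) := fun l =>
    le_of_tendsto hq_lim <| (eventually_ge_atTop l).mono fun k hk =>
      hanti (hk.trans (hφ.id_le k))
  have hminx : ∀ x ∈ X, qPen J f g h ρ xs ys ≤ qPen J f g h ρ x ys := by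
    intro x hx
    have hlim' : Tendsto (fun l => qPen J f g h ρ x (yseq (φ l))) atTop
        (nhds (qPen J f g h ρ x ys)) :=
      (hqc.tendsto (x, ys)).comp (tendsto_const_nhds.prodMk_nhds hy_lim)
    exact ge_of_tendsto' hlim' fun l =>
      (hlower (φ l + 1)).trans ((hystep _ _ (hmem _).2).trans (hxstep _ x hx))
  have hminy : ∀ y : {j // j ∈ J} → ℝ, (univ.filter fun j => y j ≠ 0).card ≤ r →
      qPen J f g h ρ xs ys ≤ qPen J f g h ρ xs y := by
    intro y hy
    have hlim' : Tendsto (fun l => qPen J f g h ρ (xseq (φ l)) y) atTop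
        (nhds (qPen J f g h ρ xs y)) :=
      (hqc.tendsto (xs, y)).comp (hx_lim.prodMk_nhds tendsto_const_nhds)
    refine le_of_tendsto_of_tendsto hq_lim hlim' ((eventually_ge_atTop 1).mono fun l hl => ?_)
    obtain ⟨k, hk⟩ := Nat.exists_eq_succ_of_ne_zero
      (Nat.one_le_iff_ne_zero.1 (hl.trans (hφ.id_le l)))
    simp only [hk]
    exact hystep k y hy
  have hev : ∀ᶠ z : (Fin n → ℝ) × ({j // j ∈ J} → ℝ) in nhds (xs, ys),
      ∀ j, ys j ≠ 0 → z.2 j ≠ 0 := by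
    refine eventually_all.2 fun j => ?_
    by_cases hj : ys j = 0
    · exact Eventually.of_forall fun _ hne => absurd hj hne
    · have hcont : Continuous fun z : (Fin n → ℝ) × ({j // j ∈ J} → ℝ) => z.2 j := by fun_prop
      exact ((hcont.tendsto (xs, ys)).eventually_ne hj).mono fun _ hz _ => hz
  obtain ⟨ε, hε, hball⟩ := Metric.eventually_nhds_iff.1 hev
  refine ⟨ε, hε, fun x hx y hy hxy => ?_⟩
  have hsupp : ∀ j, ys j ≠ 0 → y j ≠ 0 := hball (by rwa [dist_eq_norm])
  have horth : ∀ j : {j // j ∈ J}, (xs j.1 - ys j) * (y j - ys j) = 0 := by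
    intro j
    by_cases hj : y j = 0
    · have hys : ys j = 0 := by
        by_contra hne
        exact hsupp j hne hj
      rw [hj, hys, sub_self, mul_zero]
    · rw [eq_of_minimizer_of_support_subset hρ hminy hy hsupp hj, sub_self, zero_mul]
  have hsplit : ∀ x y, qPen J f g h ρ x y =
      (f x + ρ / 2 * ((∑ i, max (g x i) 0 ^ 2) + ∑ j, h x j ^ 2)) +
        ρ / 2 * ∑ j : {j // j ∈ J}, (x j.1 - y j) ^ 2 := fun x y => by
    unfold qPen
    ring
  simp only [hsplit] at hminx ⊢
  have hvar := (convexOn_penalty hhaff hfconv hgconv hρ).variational_inequality_of_sum_sq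
    hXconv hρ hxsX hminx hx
  have hsq : ∑ j : {j // j ∈ J}, (xs j.1 - ys j) ^ 2 +
      2 * ∑ j : {j // j ∈ J}, (xs j.1 - ys j) * (x j.1 - xs j.1) ≤
      ∑ j : {j // j ∈ J}, (x j.1 - y j) ^ 2 := by
    rw [mul_sum, ← sum_add_distrib]
    refine sum_le_sum fun j _ => ?_
    nlinarith [horth j, sq_nonneg ((x j.1 - y j) - (xs j.1 - ys j))]
  have := mul_le_mul_of_nonneg_left hsq (half_pos hρ).le
  linarith
end

section
/- Assume f is continuous, and let Υ ∈ ℝ and ρ_0 > 0. Let {ρ_k} be a sequence with ρ_k ≥ ρ_0 for all k, and let {(x^k, y^k)} be a sequence with x^k ∈ X, y^k ∈ Y, and q_{ρ_k}(x^k, y^k) = f(x^k) + (ρ_k/2)(‖max(g(x^k), 0)‖² + ‖h(x^k)‖² + ‖x^k_J − y^k‖²) ≤ Υ for all k. Suppose the level set X_Υ = {x ∈ X : f(x) ≤ Υ} is compact. Then the sequence {(x^k, y^k)} is bounded. -/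
open Finset

/-- Boundedness of the sequence generated by the penalty decomposition method for (P1):
if `q_{ρ_k}(x^k, y^k) ≤ Υ` with `ρ_k ≥ ρ_0 > 0`, and the level set
`X_Υ = {x ∈ X : f(x) ≤ Υ}` is compact, then `{(x^k, y^k)}` is bounded. -/
theorem pd_sequence_bounded_P1
    {n m p : ℕ} (X : Set (Fin n → ℝ)) (hXclosed : IsClosed X) (hXconv : Convex ℝ X)
    (f : (Fin n → ℝ) → ℝ) (g : (Fin n → ℝ) → Fin m → ℝ) (h : (Fin n → ℝ) → Fin p → ℝ)
    (hf : Continuous f)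
    (J : Finset (Fin n)) (r : ℕ) (hr : r ≤ J.card)
    (Υ : ℝ) (ρ0 : ℝ) (hρ0 : 0 < ρ0) (ρ : ℕ → ℝ) (hρ : ∀ k, ρ0 ≤ ρ k)
    (xseq : ℕ → Fin n → ℝ) (yseq : ℕ → {j // j ∈ J} → ℝ)
    (hmem : ∀ k, xseq k ∈ X ∧ (univ.filter fun j => yseq k j ≠ 0).card ≤ r)
    (hbound : ∀ k,
      f (xseq k) + ρ k / 2 * ((∑ i, max (g (xseq k) i) 0 ^ 2) + (∑ j, h (xseq k) j ^ 2) +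
        ∑ j : {j // j ∈ J}, (xseq k j.1 - yseq k j) ^ 2) ≤ Υ)
    (hcompact : IsCompact {x | x ∈ X ∧ f x ≤ Υ}) :
    ∃ C : ℝ, ∀ k, ‖xseq k‖ ≤ C ∧ ‖yseq k‖ ≤ C := by
  obtain ⟨B, hB⟩ := hcompact.isBounded.exists_norm_le
  obtain ⟨L, hL⟩ := hcompact.bddBelow_image hf.continuousOn
  have hlevel : ∀ k, xseq k ∈ {x | x ∈ X ∧ f x ≤ Υ} := by
    intro k
    refine ⟨(hmem k).1, ?_⟩
    have hρk : 0 ≤ ρ k / 2 := by linarith [hρ k]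
    have hpen : 0 ≤ ρ k / 2 * ((∑ i, max (g (xseq k) i) 0 ^ 2) + (∑ j, h (xseq k) j ^ 2) +
        ∑ j : {j // j ∈ J}, (xseq k j.1 - yseq k j) ^ 2) :=
      mul_nonneg hρk (by positivity)
    linarith [hbound k]
  have hB0 : 0 ≤ B := (norm_nonneg _).trans (hB _ (hlevel 0))
  have hLf : ∀ k, L ≤ f (xseq k) := fun k => hL ⟨_, hlevel k, rfl⟩
  have hD : 0 ≤ (Υ - L) / (ρ0 / 2) :=
    div_nonneg (by linarith [hLf 0, (hlevel 0).2]) (by linarith)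
  refine ⟨B + 1 + (Υ - L) / (ρ0 / 2), fun k => ⟨by linarith [hB _ (hlevel k)], ?_⟩⟩
  rw [pi_norm_le_iff_of_nonneg (by linarith)]
  intro j
  have hterm : (xseq k j.1 - yseq k j) ^ 2 ≤
      (∑ i, max (g (xseq k) i) 0 ^ 2) + (∑ j, h (xseq k) j ^ 2) +
        ∑ j : {j // j ∈ J}, (xseq k j.1 - yseq k j) ^ 2 := by
    have hsingle := single_le_sum (f := fun j : {j // j ∈ J} => (xseq k j.1 - yseq k j) ^ 2)
      (fun i _ => sq_nonneg _) (mem_univ j)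
    have hg : 0 ≤ ∑ i, max (g (xseq k) i) 0 ^ 2 := by positivity
    have hh : 0 ≤ ∑ j, h (xseq k) j ^ 2 := by positivity
    linarith
  have hsq : (xseq k j.1 - yseq k j) ^ 2 ≤ (Υ - L) / (ρ0 / 2) := by
    rw [le_div_iff₀' (by linarith)]
    have hmul := mul_le_mul (show ρ0 / 2 ≤ ρ k / 2 by linarith [hρ k]) hterm (sq_nonneg _)
      (by linarith [hρ k])
    linarith [hbound k, hLf k]
  have hx : |xseq k j.1| ≤ B := (norm_le_pi_norm (xseq k) j.1).trans (hB _ (hlevel k))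
  rw [Real.norm_eq_abs, abs_le]
  constructor <;>
    nlinarith [sq_nonneg (xseq k j.1 - yseq k j - 1),
      sq_nonneg (xseq k j.1 - yseq k j + 1), (abs_le.mp hx).1, (abs_le.mp hx).2]
end

section
/- Assume each component h_j of h is an affine function and that f and each component g_i of g are convex, and let ν ≥ 0 and ρ > 0. Suppose (x*, y*) ∈ ℝⁿ × ℝ^J is a saddle point of the penalty function p_ρ, that is, x* ∈ X minimizes p_ρ(·, y*) over X and y* minimizes p_ρ(x*, ·) over ℝ^J. Then (x*, y*) is a local minimizer of p_ρ over X × ℝ^J: there exists ε > 0 such that p_ρ(x, y) ≥ p_ρ(x*, y*) for all x ∈ X and y ∈ ℝ^J with ‖(x, y) − (x*, y*)‖ < ε. -/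
open Finset

/-- The penalty function `p_ρ(x,y) = f(x) + ν‖y‖₀ + (ρ/2)(‖max(g(x),0)‖² + ‖h(x)‖²
+ ‖x_J − y‖²)` associated with problem (P2). -/
noncomputable def pPen {n m p : ℕ} (J : Finset (Fin n))
    (f : (Fin n → ℝ) → ℝ) (g : (Fin n → ℝ) → Fin m → ℝ) (h : (Fin n → ℝ) → Fin p → ℝ)
    (ν ρ : ℝ) (x : Fin n → ℝ) (y : {j // j ∈ J} → ℝ) : ℝ :=
  f x + ν * ((univ.filter fun j => y j ≠ 0).card : ℝ) +
    ρ / 2 * ((∑ i, max (g x i) 0 ^ 2) + (∑ j, h x j ^ 2) +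
      ∑ j : {j // j ∈ J}, (x j.1 - y j) ^ 2)

/-- First-order condition for a minimizer `a` over a convex set of the sum of a convex function and
a separable quadratic. -/
theorem ConvexOn.le_add_sum_of_isMinOn_add_sq {n : ℕ} {ι : Type*} [Fintype ι] (e : ι → Fin n)
    {X : Set (Fin n → ℝ)} (hX : Convex ℝ X) {F : (Fin n → ℝ) → ℝ} (hF : ConvexOn ℝ Set.univ F)
    {c : ℝ} {a : Fin n → ℝ} (ha : a ∈ X) {b : ι → ℝ}
    (hmin : ∀ x ∈ X, F a + c * ∑ j, (a (e j) - b j) ^ 2 ≤ F x + c * ∑ j, (x (e j) - b j) ^ 2)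
    {x : Fin n → ℝ} (hx : x ∈ X) :
    F a ≤ F x + c * ∑ j, 2 * (a (e j) - b j) * (x (e j) - a (e j)) := by
  set A := ∑ j, 2 * (a (e j) - b j) * (x (e j) - a (e j)) with hA
  set B := ∑ j, (x (e j) - a (e j)) ^ 2 with hB
  have key : ∀ t ∈ Set.Ioo (0 : ℝ) 1, 0 ≤ F x - F a + c * A + t * (c * B) := by
    rintro t ⟨ht0, ht1⟩
    have h1 := hmin _ (hX ha hx (sub_nonneg.2 ht1.le) ht0.le (by ring))
    have h2 := hF.2 (Set.mem_univ a) (Set.mem_univ x) (sub_nonneg.2 ht1.le) ht0.le (by ring)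
    have h3 : ∑ j, (((1 - t) • a + t • x) (e j) - b j) ^ 2
        = ∑ j, (a (e j) - b j) ^ 2 + t * A + t ^ 2 * B := by
      rw [hA, hB, mul_sum, mul_sum, ← sum_add_distrib, ← sum_add_distrib]
      refine sum_congr rfl fun j _ => ?_
      simp only [Pi.add_apply, Pi.smul_apply, smul_eq_mul]
      ring
    rw [h3] at h1
    simp only [smul_eq_mul] at h2
    have h4 : 0 ≤ t * (F x - F a + c * A + t * (c * B)) := by linarith
    exact nonneg_of_mul_nonneg_right h4 ht0
  have hlim : Filter.Tendsto (fun t : ℝ => F x - F a + c * A + t * (c * B))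
      (nhdsWithin 0 (Set.Ioi 0)) (nhds (F x - F a + c * A + 0 * (c * B))) :=
    (Continuous.tendsto (by fun_prop) 0).mono_left nhdsWithin_le_nhds
  have h0 := ge_of_tendsto hlim
    (Filter.eventually_of_mem (Ioo_mem_nhdsGT zero_lt_one) key)
  linarith

/-- The part of the penalty function that depends on `x` alone. -/
noncomputable def penX {n m p : ℕ} (f : (Fin n → ℝ) → ℝ) (g : (Fin n → ℝ) → Fin m → ℝ)
    (h : (Fin n → ℝ) → Fin p → ℝ) (ρ : ℝ) (x : Fin n → ℝ) : ℝ :=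
  f x + ρ / 2 * ((∑ i, max (g x i) 0 ^ 2) + ∑ j, h x j ^ 2)

theorem pPen_eq {n m p : ℕ} (J : Finset (Fin n))
    (f : (Fin n → ℝ) → ℝ) (g : (Fin n → ℝ) → Fin m → ℝ) (h : (Fin n → ℝ) → Fin p → ℝ)
    (ν ρ : ℝ) (x : Fin n → ℝ) (y : {j // j ∈ J} → ℝ) :
    pPen J f g h ν ρ x y = penX f g h ρ x + ν * ((univ.filter fun j => y j ≠ 0).card : ℝ) +
      ρ / 2 * ∑ j : {j // j ∈ J}, (x j.1 - y j) ^ 2 := by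
  unfold pPen penX
  ring

theorem convexOn_penX {n m p : ℕ} {f : (Fin n → ℝ) → ℝ} {g : (Fin n → ℝ) → Fin m → ℝ}
    {h : (Fin n → ℝ) → Fin p → ℝ} {ρ : ℝ} (hρ : 0 ≤ ρ)
    (hhaff : ∀ j, ∃ (w : Fin n → ℝ) (b : ℝ), ∀ x, h x j = (∑ i, w i * x i) + b)
    (hf : ConvexOn ℝ Set.univ f) (hg : ∀ i, ConvexOn ℝ Set.univ fun x => g x i) :
    ConvexOn ℝ Set.univ (penX f g h ρ) := by
  have hsum : ∀ {k : ℕ} (u : Fin k → (Fin n → ℝ) → ℝ), (∀ i, ConvexOn ℝ Set.univ (u i)) →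
      ConvexOn ℝ Set.univ fun x => ∑ i, u i x := by
    intro k u hu
    refine ⟨convex_univ, fun x _ y _ a b ha hb hab => ?_⟩
    rw [smul_sum, smul_sum, ← sum_add_distrib]
    exact sum_le_sum fun i _ => (hu i).2 trivial trivial ha hb hab
  have hG : ∀ i, ConvexOn ℝ Set.univ fun x => max (g x i) 0 ^ 2 := fun i =>
    ((hg i).sup (convexOn_const 0 convex_univ)).pow (fun _ _ => le_max_right _ _) 2
  have hH : ∀ j, ConvexOn ℝ Set.univ fun x => h x j ^ 2 := by
    intro j
    obtain ⟨w, b, hw⟩ := hhaff j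
    refine ⟨convex_univ, fun x _ y _ s t hs ht hst => ?_⟩
    have hcomb : h (s • x + t • y) j = s * h x j + t * h y j := by
      have hb : b = s * b + t * b := by rw [← add_mul, hst, one_mul]
      have hsplit : ∑ i, w i * (s • x + t • y) i
          = s * ∑ i, w i * x i + t * ∑ i, w i * y i := by
        rw [mul_sum, mul_sum, ← sum_add_distrib]
        refine sum_congr rfl fun i _ => ?_
        simp only [Pi.add_apply, Pi.smul_apply, smul_eq_mul]
        ring
      rw [hw, hw, hw, hsplit]
      linarith
    have hpow := (even_two.convexOn_pow (𝕜 := ℝ)).2 (Set.mem_univ (h x j)) (Set.mem_univ (h y j))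
      hs ht hst
    simpa only [hcomb, smul_eq_mul] using hpow
  exact hf.add (((hsum _ hG).add (hsum _ hH)).smul (by positivity : 0 ≤ ρ / 2))

/-- A block minimizer in `y` agrees with `x` at each coordinate that the cardinality term does not
push to zero. -/
theorem eq_of_pPen_le {n m p : ℕ} {J : Finset (Fin n)}
    {f : (Fin n → ℝ) → ℝ} {g : (Fin n → ℝ) → Fin m → ℝ} {h : (Fin n → ℝ) → Fin p → ℝ}
    {ν ρ : ℝ} (hν : 0 ≤ ν) (hρ : 0 < ρ) {x : Fin n → ℝ} {y : {j // j ∈ J} → ℝ}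
    (hmin : ∀ z, pPen J f g h ν ρ x y ≤ pPen J f g h ν ρ x z)
    {j : {j // j ∈ J}} (hj : ν = 0 ∨ y j ≠ 0) : x j.1 = y j := by
  have hz := hmin (Function.update y j (x j.1))
  rw [pPen_eq, pPen_eq] at hz
  have hcard : ν * ((univ.filter fun k => Function.update y j (x j.1) k ≠ 0).card : ℝ)
      ≤ ν * ((univ.filter fun k => y k ≠ 0).card : ℝ) := by
    rcases hj with rfl | hj
    · simp
    · refine mul_le_mul_of_nonneg_left (Nat.cast_le.2 (card_le_card fun k hk => ?_)) hν
      rcases eq_or_ne k j with rfl | hkj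
      · simpa using hj
      · simpa [Function.update_of_ne hkj] using hk
  have hsum : ∑ k : {j // j ∈ J}, (x k.1 - Function.update y j (x j.1) k) ^ 2
      + (x j.1 - y j) ^ 2 = ∑ k : {j // j ∈ J}, (x k.1 - y k) ^ 2 := by
    rw [← add_sum_erase _ _ (mem_univ j), ← add_sum_erase _ (fun k => (x k.1 - y k) ^ 2)
      (mem_univ j), sum_congr rfl fun k hk => by rw [Function.update_of_ne (ne_of_mem_erase hk)]]
    simp only [Function.update_self]
    ring
  rw [← hsum] at hz
  have hsq : ρ / 2 * (x j.1 - y j) ^ 2 ≤ 0 := by linarith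
  have hsq' : (x j.1 - y j) ^ 2 ≤ 0 := nonpos_of_mul_nonpos_right hsq (by positivity)
  exact sub_eq_zero.1 (pow_eq_zero_iff two_ne_zero |>.1 (le_antisymm hsq' (sq_nonneg _)))

/-- A saddle point of the penalty subproblem `min p_ρ(x,y)` over `X × ℝ^J` is a local
minimizer of it, provided `h` is affine and `f`, `g` are convex. -/
theorem saddle_point_is_local_min_pPen
    {n m p : ℕ} (X : Set (Fin n → ℝ)) (hXclosed : IsClosed X) (hXconv : Convex ℝ X)
    (f : (Fin n → ℝ) → ℝ) (g : (Fin n → ℝ) → Fin m → ℝ) (h : (Fin n → ℝ) → Fin p → ℝ)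
    (hf : ContDiff ℝ 1 f) (hg : ∀ i, ContDiff ℝ 1 fun x => g x i)
    (hh : ∀ j, ContDiff ℝ 1 fun x => h x j)
    -- h affine, f and g convex
    (hhaff : ∀ j, ∃ (w : Fin n → ℝ) (b : ℝ), ∀ x, h x j = (∑ i, w i * x i) + b)
    (hfconv : ConvexOn ℝ Set.univ f) (hgconv : ∀ i, ConvexOn ℝ Set.univ fun x => g x i)
    (J : Finset (Fin n)) (ν : ℝ) (hν : 0 ≤ ν) (ρ : ℝ) (hρ : 0 < ρ)
    (xs : Fin n → ℝ) (ys : {j // j ∈ J} → ℝ)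
    -- (x*, y*) is a saddle point of p_ρ
    (hxs : xs ∈ X)
    (hsadx : ∀ x ∈ X, pPen J f g h ν ρ xs ys ≤ pPen J f g h ν ρ x ys)
    (hsady : ∀ y : {j // j ∈ J} → ℝ, pPen J f g h ν ρ xs ys ≤ pPen J f g h ν ρ xs y) :
    -- then (x*, y*) is a local minimizer of p_ρ over X × ℝ^J
    ∃ ε > 0, ∀ x ∈ X, ∀ y : {j // j ∈ J} → ℝ,
      ‖(x, y) - (xs, ys)‖ < ε → pPen J f g h ν ρ xs ys ≤ pPen J f g h ν ρ x y := by
  have hFconv := convexOn_penX (ρ := ρ) hρ.le hhaff hfconv hgconv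
  have hFcont : Continuous (penX f g h ρ) := by
    have hf' := hf.continuous
    have hg' := fun i => (hg i).continuous
    have hh' := fun j => (hh j).continuous
    unfold penX
    fun_prop
  have hgrad := fun x (hx : x ∈ X) => hFconv.le_add_sum_of_isMinOn_add_sq (c := ρ / 2)
    (fun j : {j // j ∈ J} => j.1) hXconv hxs (b := ys)
    (fun z hz => by have := hsadx z hz; rw [pPen_eq, pPen_eq] at this; linarith) hx
  have hsupp : ∀ᶠ z : (Fin n → ℝ) × ({j // j ∈ J} → ℝ) in nhds (xs, ys),
      ∀ j, ys j ≠ 0 → z.2 j ≠ 0 := by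
    refine Filter.eventually_all.2 fun j => ?_
    by_cases hj : ys j = 0
    · simp [hj]
    · have hc : Continuous fun z : (Fin n → ℝ) × ({j // j ∈ J} → ℝ) => z.2 j := by fun_prop
      filter_upwards [hc.continuousAt.eventually_ne (x := (xs, ys)) hj] with z hz _ using hz
  have hsmooth : ∀ᶠ z : (Fin n → ℝ) × ({j // j ∈ J} → ℝ) in nhds (xs, ys), ν = 0 ∨
      penX f g h ρ xs + ρ / 2 * ∑ j : {j // j ∈ J}, (xs j.1 - ys j) ^ 2 - ν
        < penX f g h ρ z.1 + ρ / 2 * ∑ j : {j // j ∈ J}, (z.1 j.1 - z.2 j) ^ 2 := by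
    rcases hν.eq_or_lt with h0 | hpos
    · exact .of_forall fun _ => .inl h0.symm
    · have hc : Continuous fun z : (Fin n → ℝ) × ({j // j ∈ J} → ℝ) =>
          penX f g h ρ z.1 + ρ / 2 * ∑ j : {j // j ∈ J}, (z.1 j.1 - z.2 j) ^ 2 := by
        fun_prop
      filter_upwards [hc.tendsto (xs, ys) |>.eventually_const_lt (sub_lt_self _ hpos)]
        with z hz using .inr hz
  obtain ⟨ε, hε, hball⟩ := Metric.eventually_nhds_iff.1 (hsupp.and hsmooth)
  refine ⟨ε, hε, fun x hx y hxy => ?_⟩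
  obtain ⟨hsub, hsm⟩ := hball (by rwa [dist_eq_norm])
  have hss : (univ.filter fun j => ys j ≠ 0) ⊆ univ.filter fun j => y j ≠ 0 := by
    intro j hj
    simpa using hsub j (by simpa using hj)
  rw [pPen_eq, pPen_eq]
  by_cases hcase : ν = 0 ∨ (univ.filter fun j => ys j ≠ 0) = univ.filter fun j => y j ≠ 0
  · have hcard : ν * ((univ.filter fun j => ys j ≠ 0).card : ℝ)
        ≤ ν * ((univ.filter fun j => y j ≠ 0).card : ℝ) :=
      mul_le_mul_of_nonneg_left (Nat.cast_le.2 (card_le_card hss)) hν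
    have hsum : ∑ j : {j // j ∈ J}, (xs j.1 - ys j) ^ 2
        + ∑ j : {j // j ∈ J}, 2 * (xs j.1 - ys j) * (x j.1 - xs j.1)
        ≤ ∑ j : {j // j ∈ J}, (x j.1 - y j) ^ 2 := by
      rw [← sum_add_distrib]
      refine sum_le_sum fun j _ => ?_
      by_cases hj : ν = 0 ∨ ys j ≠ 0
      · rw [eq_of_pPen_le hν hρ hsady hj]
        nlinarith [sq_nonneg (x j.1 - y j)]
      · push Not at hj
        have hyj : y j = 0 := by
          have hmem := Finset.ext_iff.1 (hcase.resolve_left hj.1) j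
          simpa [hj.2] using hmem
        rw [hj.2, hyj]
        nlinarith [sq_nonneg (x j.1 - xs j.1)]
    have hmul := mul_le_mul_of_nonneg_left hsum (by positivity : 0 ≤ ρ / 2)
    linarith [hgrad x hx]
  · push Not at hcase
    have hlt : ((univ.filter fun j => ys j ≠ 0).card : ℝ) + 1
        ≤ ((univ.filter fun j => y j ≠ 0).card : ℝ) := by
      exact_mod_cast card_lt_card (hss.ssubset_of_ne hcase.2)
    have hmul := mul_le_mul_of_nonneg_left hlt hν
    have hsm' := hsm.resolve_left hcase.1
    simp only at hsm'
    linarith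
end

section
/- Assume f, g and h are continuous, and let ν ≥ 0 and ρ > 0. Let {(x^l, y^l)}_{l ≥ 0} be a sequence generated by the block coordinate descent method: for each l, x^{l+1} ∈ X minimizes p_ρ(·, y^l) over X and y^{l+1} ∈ ℝ^J minimizes p_ρ(x^{l+1}, ·) over ℝ^J. Suppose (x*, y*) is an accumulation point of {(x^l, y^l)}. Then (x*, y*) is a saddle point of p_ρ: x* ∈ X minimizes p_ρ(·, y*) over X, and y* minimizes p_ρ(x*, ·) over ℝ^J. -/
open Finset Filter

/-- If block coordinate descent on `S (x, y) + N y`, with `S` continuous and `N` locally minimal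
at every point, has an accumulation point, then that point is a saddle point. -/
theorem isSaddle_of_bcd_accumulation {E F : Type*} [TopologicalSpace E] [TopologicalSpace F]
    {X : Set E} (hX : IsClosed X) {S : E × F → ℝ} (hS : Continuous S) {N : F → ℝ}
    (hN : ∀ y₀, ∀ᶠ y in nhds y₀, N y₀ ≤ N y) {x : ℕ → E} {y : ℕ → F} (hmem : ∀ l, x l ∈ X)
    (hx : ∀ l, ∀ u ∈ X, S (x (l + 1), y l) + N (y l) ≤ S (u, y l) + N (y l))
    (hy : ∀ l v, S (x (l + 1), y (l + 1)) + N (y (l + 1)) ≤ S (x (l + 1), v) + N v)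
    {xs : E} {ys : F} {φ : ℕ → ℕ} (hφ : StrictMono φ)
    (hlim : Tendsto (fun l => (x (φ l), y (φ l))) atTop (nhds (xs, ys))) :
    (xs ∈ X ∧ ∀ u ∈ X, S (xs, ys) + N ys ≤ S (u, ys) + N ys) ∧
      ∀ v, S (xs, ys) + N ys ≤ S (xs, v) + N v := by
  have hxl : Tendsto (fun l => x (φ l)) atTop (nhds xs) := hlim.fst_nhds
  have hyl : Tendsto (fun l => y (φ l)) atTop (nhds ys) := hlim.snd_nhds
  have hSl : Tendsto (fun l => S (x (φ l), y (φ l))) atTop (nhds (S (xs, ys))) :=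
    (hS.tendsto _).comp hlim
  have hSx (v : F) : Tendsto (fun l => S (x (φ l), v)) atTop (nhds (S (xs, v))) :=
    (hS.tendsto _).comp (hxl.prodMk_nhds tendsto_const_nhds)
  have hSy (u : E) : Tendsto (fun l => S (u, y (φ l))) atTop (nhds (S (u, ys))) :=
    (hS.tendsto _).comp (tendsto_const_nhds.prodMk_nhds hyl)
  have hNl : ∀ᶠ l in atTop, N ys ≤ N (y (φ l)) := hyl.eventually (hN ys)
  have hymin : ∀ᶠ l in atTop, ∀ v,
      S (x (φ l), y (φ l)) + N (y (φ l)) ≤ S (x (φ l), v) + N v := by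
    filter_upwards [eventually_ge_atTop 1] with l hl v
    obtain ⟨k, hk⟩ := Nat.exists_eq_add_of_le' (hl.trans (hφ.id_le l))
    simpa [hk] using hy k v
  have hanti : Antitone fun l => S (x l, y l) + N (y l) :=
    antitone_nat_of_succ_le fun l => (hy l (y l)).trans (hx l _ (hmem l))
  refine ⟨⟨hX.mem_of_tendsto hxl (Eventually.of_forall fun l => hmem _), fun u hu => ?_⟩,
    fun v => ?_⟩
  · have hupper : Tendsto
        (fun l => S (u, y (φ l)) + (S (x (φ l), ys) - S (x (φ l), y (φ l)) + N ys)) atTop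
        (nhds (S (u, ys) + (S (xs, ys) - S (xs, ys) + N ys))) :=
      (hSy u).add (((hSx ys).sub hSl).add_const _)
    rw [sub_self, zero_add] at hupper
    refine le_of_tendsto_of_tendsto ((tendsto_add_atTop_iff_nat 1).2 (hSl.add_const (N ys)))
      hupper ?_
    filter_upwards [(tendsto_add_atTop_nat 1).eventually hNl, hymin] with l hl hmin
    have hdesc := hanti (Nat.succ_le_of_lt (hφ (Nat.lt_succ_self l)))
    have hstep := (hy (φ l) (y (φ l))).trans (hx (φ l) u hu)
    have hbound := hmin ys
    simp only [Nat.succ_eq_add_one] at hdesc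
    linarith
  · refine le_of_tendsto_of_tendsto (hSl.add_const (N ys)) ((hSx v).add_const (N v)) ?_
    filter_upwards [hNl, hymin] with l hl hmin
    linarith [hmin v]

/-- The number of nonzero entries is locally minimal at every point. -/
theorem eventually_card_ne_zero_le {ι : Type*} [Fintype ι] (y₀ : ι → ℝ) :
    ∀ᶠ y in nhds y₀,
      (univ.filter fun j => y₀ j ≠ 0).card ≤ (univ.filter fun j => y j ≠ 0).card := by
  have hne : ∀ᶠ y in nhds y₀, ∀ j, y₀ j ≠ 0 → y j ≠ 0 := by
    refine eventually_all.2 fun j => ?_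
    by_cases hj : y₀ j = 0
    · simp [hj]
    · filter_upwards [(continuous_apply j).continuousAt.eventually_ne hj] with y hy _ using hy
  filter_upwards [hne] with y hy
  exact card_le_card (monotone_filter_right _ fun j _ => hy j)

/-- Any accumulation point of the sequence generated by the block coordinate descent
method applied to `min p_ρ(x,y)` over `X × ℝ^J` is a saddle point of this problem. -/
theorem bcd_accumulation_point_is_saddle_point_pPen
    {n m p : ℕ} (X : Set (Fin n → ℝ)) (hXclosed : IsClosed X) (hXconv : Convex ℝ X)
    (f : (Fin n → ℝ) → ℝ) (g : (Fin n → ℝ) → Fin m → ℝ) (h : (Fin n → ℝ) → Fin p → ℝ)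
    (hf : Continuous f) (hg : Continuous g) (hh : Continuous h)
    (J : Finset (Fin n)) (ν : ℝ) (hν : 0 ≤ ν) (ρ : ℝ) (hρ : 0 < ρ)
    -- the BCD sequence
    (xseq : ℕ → Fin n → ℝ) (yseq : ℕ → {j // j ∈ J} → ℝ)
    (hmem : ∀ l, xseq l ∈ X)
    (hxstep : ∀ l, ∀ x ∈ X,
      pPen J f g h ν ρ (xseq (l + 1)) (yseq l) ≤ pPen J f g h ν ρ x (yseq l))
    (hystep : ∀ l, ∀ y : {j // j ∈ J} → ℝ,
      pPen J f g h ν ρ (xseq (l + 1)) (yseq (l + 1)) ≤ pPen J f g h ν ρ (xseq (l + 1)) y)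
    -- (x*, y*) is an accumulation point of the sequence
    (xs : Fin n → ℝ) (ys : {j // j ∈ J} → ℝ)
    (hacc : ∃ φ : ℕ → ℕ, StrictMono φ ∧
      Tendsto (fun l => (xseq (φ l), yseq (φ l))) atTop (nhds (xs, ys))) :
    -- then (x*, y*) is a saddle point of p_ρ
    (xs ∈ X ∧ ∀ x ∈ X, pPen J f g h ν ρ xs ys ≤ pPen J f g h ν ρ x ys) ∧
    (∀ y : {j // j ∈ J} → ℝ, pPen J f g h ν ρ xs ys ≤ pPen J f g h ν ρ xs y) := by
  obtain ⟨φ, hφ, hlim⟩ := hacc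
  let S : (Fin n → ℝ) × ({j // j ∈ J} → ℝ) → ℝ := fun z =>
    f z.1 + ρ / 2 * ((∑ i, max (g z.1 i) 0 ^ 2) + (∑ j, h z.1 j ^ 2) +
      ∑ j : {j // j ∈ J}, (z.1 j.1 - z.2 j) ^ 2)
  let N : ({j // j ∈ J} → ℝ) → ℝ := fun y => ν * ((univ.filter fun j => y j ≠ 0).card : ℝ)
  have hpen : ∀ x y, pPen J f g h ν ρ x y = S (x, y) + N y := fun x y => add_right_comm _ _ _
  have hS : Continuous S := by fun_prop
  have hN : ∀ y₀, ∀ᶠ y in nhds y₀, N y₀ ≤ N y := fun y₀ =>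
    (eventually_card_ne_zero_le y₀).mono fun y hy =>
      mul_le_mul_of_nonneg_left (Nat.cast_le.2 hy) hν
  simp only [hpen] at hxstep hystep ⊢
  exact isSaddle_of_bcd_accumulation hXclosed hS hN hmem hxstep hystep hφ hlim
end

section
/- Assume f, g and h are continuous, let ν ≥ 0 and Υ ∈ ℝ, and let {ρ_k} be positive numbers with ρ_k ≥ ρ_0 > 0 and ρ_k → ∞. Let {(x^k, y^k)} be a sequence with x^k ∈ X, y^k ∈ ℝ^J, and p_{ρ_k}(x^k, y^k) = f(x^k) + ν‖y^k‖₀ + (ρ_k/2)(‖max(g(x^k), 0)‖² + ‖h(x^k)‖² + ‖x^k_J − y^k‖²) ≤ Υ for all k. Suppose the level set X_Υ = {x ∈ X : f(x) ≤ Υ} is compact. Then: (a) the sequence {(x^k, y^k)} is bounded; and (b) if (x*, y*) is an accumulation point of {(x^k, y^k)}, then x*_J = y* and x* is a feasible point of the problem (P2): x* ∈ X, g(x*) ≤ 0 componentwise, and h(x*) = 0. -/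
open Finset Filter

/-- A nonnegative sequence `s` with `ρ k / 2 * s k` bounded above and `ρ → ∞` tends to `0`. -/
theorem tendsto_zero_of_half_mul_le {ρ s : ℕ → ℝ} {M : ℝ} (hρpos : ∀ k, 0 < ρ k)
    (hρ : Tendsto ρ atTop atTop) (hs : ∀ k, 0 ≤ s k) (hM : ∀ k, ρ k / 2 * s k ≤ M) :
    Tendsto s atTop (nhds 0) := by
  refine squeeze_zero hs (fun k => ?_) ((tendsto_const_nhds (x := 2 * M)).div_atTop hρ)
  rw [le_div_iff₀ (hρpos k)]
  linarith [hM k]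

/-- Boundedness of the penalty decomposition sequence for (P2) and feasibility of its
accumulation points: if `p_{ρ_k}(x^k, y^k) ≤ Υ`, `ρ_k ≥ ρ_0 > 0`, `ρ_k → ∞`, and the
level set `X_Υ = {x ∈ X : f(x) ≤ Υ}` is compact, then `{(x^k, y^k)}` is bounded and any
accumulation point `(x*, y*)` satisfies `x*_J = y*` with `x*` feasible for (P2). -/
theorem pd_sequence_bounded_and_feasible_P2
    {n m p : ℕ} (X : Set (Fin n → ℝ)) (hXclosed : IsClosed X) (hXconv : Convex ℝ X)
    (f : (Fin n → ℝ) → ℝ) (g : (Fin n → ℝ) → Fin m → ℝ) (h : (Fin n → ℝ) → Fin p → ℝ)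
    (hf : Continuous f) (hg : Continuous g) (hh : Continuous h)
    (J : Finset (Fin n)) (ν : ℝ) (hν : 0 ≤ ν) (Υ : ℝ)
    (ρ0 : ℝ) (hρ0 : 0 < ρ0) (ρ : ℕ → ℝ) (hρge : ∀ k, ρ0 ≤ ρ k)
    (hρ : Tendsto ρ atTop atTop)
    (xseq : ℕ → Fin n → ℝ) (yseq : ℕ → {j // j ∈ J} → ℝ)
    (hmem : ∀ k, xseq k ∈ X)
    (hbound : ∀ k,
      f (xseq k) + ν * ((univ.filter fun j => yseq k j ≠ 0).card : ℝ) +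
        ρ k / 2 * ((∑ i, max (g (xseq k) i) 0 ^ 2) + (∑ j, h (xseq k) j ^ 2) +
          ∑ j : {j // j ∈ J}, (xseq k j.1 - yseq k j) ^ 2) ≤ Υ)
    (hcompact : IsCompact {x | x ∈ X ∧ f x ≤ Υ}) :
    -- (a) the sequence is bounded
    (∃ C : ℝ, ∀ k, ‖xseq k‖ ≤ C ∧ ‖yseq k‖ ≤ C) ∧
    -- (b) accumulation points satisfy x*_J = y* and are feasible for (P2)
    (∀ (xs : Fin n → ℝ) (ys : {j // j ∈ J} → ℝ),
      (∃ φ : ℕ → ℕ, StrictMono φ ∧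
        Tendsto (fun k => (xseq (φ k), yseq (φ k))) atTop (nhds (xs, ys))) →
      (∀ j : {j // j ∈ J}, xs j.1 = ys j) ∧
      xs ∈ X ∧ (∀ i, g xs i ≤ 0) ∧ (∀ j, h xs j = 0)) := by
  set S : (Fin n → ℝ) → ({j // j ∈ J} → ℝ) → ℝ := fun x y =>
    (∑ i, max (g x i) 0 ^ 2) + (∑ j, h x j ^ 2) + ∑ j : {j // j ∈ J}, (x j.1 - y j) ^ 2 with hS
  have hg_nonneg (x) : 0 ≤ ∑ i, max (g x i) 0 ^ 2 := sum_nonneg fun _ _ => sq_nonneg _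
  have hh_nonneg (x) : 0 ≤ ∑ j, h x j ^ 2 := sum_nonneg fun _ _ => sq_nonneg _
  have hy_nonneg (x : Fin n → ℝ) (y : {j // j ∈ J} → ℝ) :
      0 ≤ ∑ j : {j // j ∈ J}, (x j.1 - y j) ^ 2 := sum_nonneg fun _ _ => sq_nonneg _
  have hS_nonneg (x y) : 0 ≤ S x y :=
    add_nonneg (add_nonneg (hg_nonneg x) (hh_nonneg x)) (hy_nonneg x y)
  have hρpos (k) : 0 < ρ k := hρ0.trans_le (hρge k)
  have hpen (k) : f (xseq k) + ρ k / 2 * S (xseq k) (yseq k) ≤ Υ := by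
    have hcard : 0 ≤ ν * ((univ.filter fun j => yseq k j ≠ 0).card : ℝ) := by positivity
    linarith [hbound k]
  have hlevel (k) : xseq k ∈ {x | x ∈ X ∧ f x ≤ Υ} := by
    have : 0 ≤ ρ k / 2 * S (xseq k) (yseq k) :=
      mul_nonneg (half_pos (hρpos k)).le (hS_nonneg _ _)
    exact ⟨hmem k, by linarith [hpen k]⟩
  obtain ⟨L, hL⟩ := (hcompact.image hf).bddBelow
  have hS_lim : Tendsto (fun k => S (xseq k) (yseq k)) atTop (nhds 0) :=
    tendsto_zero_of_half_mul_le (M := Υ - L) hρpos hρ (fun k => hS_nonneg _ _) fun k => by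
      linarith [hpen k, hL (Set.mem_image_of_mem f (hlevel k))]
  refine ⟨?_, ?_⟩
  · obtain ⟨R, hR⟩ := hcompact.isBounded.exists_norm_le
    obtain ⟨B, hB⟩ := hS_lim.bddAbove_range
    have hB_nonneg : 0 ≤ B := (hS_nonneg _ _).trans (hB (Set.mem_range_self 0))
    have hR_nonneg : 0 ≤ R := (norm_nonneg _).trans (hR _ (hlevel 0))
    refine ⟨R + √B, fun k => ⟨?_, ?_⟩⟩
    · linarith [hR _ (hlevel k), Real.sqrt_nonneg B]
    · refine (pi_norm_le_iff_of_nonneg (by positivity)).2 fun j => ?_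
      have hterm : (xseq k j.1 - yseq k j) ^ 2 ≤ B := by
        have h₁ := single_le_sum (f := fun j : {j // j ∈ J} => (xseq k j.1 - yseq k j) ^ 2)
          (fun _ _ => sq_nonneg _) (mem_univ j)
        have h₂ : S (xseq k) (yseq k) ≤ B := hB (Set.mem_range_self k)
        simp only [hS] at h₁ h₂
        linarith [hg_nonneg (xseq k), hh_nonneg (xseq k)]
      have hdiff := abs_le.1 (Real.abs_le_sqrt hterm)
      have hx := abs_le.1 ((norm_le_pi_norm (xseq k) j.1).trans (hR _ (hlevel k)))
      exact abs_le.2 ⟨by linarith, by linarith⟩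
  · rintro xs ys ⟨φ, hφ, hlim⟩
    have hS_cont : Continuous fun z : (Fin n → ℝ) × ({j // j ∈ J} → ℝ) => S z.1 z.2 := by
      simp only [hS]
      fun_prop
    have hS_zero : S xs ys = 0 := tendsto_nhds_unique
      ((hS_cont.tendsto (xs, ys)).comp hlim) (hS_lim.comp hφ.tendsto_atTop)
    simp only [hS] at hS_zero
    have hg₀ : ∑ i, max (g xs i) 0 ^ 2 = 0 := by
      linarith [hg_nonneg xs, hh_nonneg xs, hy_nonneg xs ys]
    have hh₀ : ∑ j, h xs j ^ 2 = 0 := by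
      linarith [hg_nonneg xs, hh_nonneg xs, hy_nonneg xs ys]
    have hy₀ : ∑ j : {j // j ∈ J}, (xs j.1 - ys j) ^ 2 = 0 := by
      linarith [hg_nonneg xs, hh_nonneg xs, hy_nonneg xs ys]
    rw [sum_eq_zero_iff_of_nonneg fun _ _ => sq_nonneg _] at hg₀ hh₀ hy₀
    exact ⟨fun j => sub_eq_zero.1 (sq_eq_zero_iff.1 (hy₀ j (mem_univ j))),
      hXclosed.mem_of_tendsto ((continuous_fst.tendsto (xs, ys)).comp hlim)
        (Eventually.of_forall fun k => hmem (φ k)),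
      fun i => max_eq_right_iff.1 (sq_eq_zero_iff.1 (hg₀ i (mem_univ i))),
      fun j => sq_eq_zero_iff.1 (hh₀ j (mem_univ j))⟩
end

section
/- Let p ∈ (0, 1], let b¹, b² ∈ ℝⁿ with (b¹, b²) ≠ 0, and set α = (Σ_{i=1}^n |b¹_i|^p + Σ_{i=1}^n |b²_i|^p)^{1/p} and b = b¹ + b². Define the linear map A : ℝ^{2+2n} → ℝⁿ by A(t₁, t₂, u, w) = t₁ b¹ + t₂ b² + α u + α w, and for ν > 0 define f(x) = (1/2)‖Ax − b‖² + ν‖x‖_p, where ‖x‖_p = (Σ_i |x_i|^p)^{1/p}. Let x^s = (1, 1, 0, 0) and x̄ = (0, 0, b¹/α, b²/α). Then A x^s = b and A x̄ = b, f(x^s) = 2^{1/p} ν and f(x̄) = ν; consequently f(x^s) > f(x̄), so x^s is not a global minimizer of f, and if f* denotes the infimum of f over ℝ^{2+2n} and f* > 0, then (f(x^s) − f*)/f* ≥ 2^{1/p} − 1 ≥ 1. -/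
open Finset

theorem sum_abs_rpow_add_sum_abs_rpow_pos {ι : Type*} [Fintype ι] (p : ℝ) (u v : ι → ℝ)
    (huv : (u, v) ≠ 0) : 0 < (∑ i, |u i| ^ p) + ∑ i, |v i| ^ p := by
  have nonneg (w : ι → ℝ) : 0 ≤ ∑ i, |w i| ^ p := by positivity
  have pos {w : ι → ℝ} (hw : w ≠ 0) : 0 < ∑ i, |w i| ^ p := by
    obtain ⟨i, hi⟩ := Function.ne_iff.mp hw
    exact Finset.sum_pos' (fun j _ => by positivity)
      ⟨i, Finset.mem_univ i, Real.rpow_pos_of_pos (abs_pos.mpr hi) p⟩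
  by_cases hu : u = 0
  · have hv : v ≠ 0 := fun hv => huv (by rw [hu, hv]; rfl)
    exact add_pos_of_nonneg_of_pos (nonneg u) (pos hv)
  · exact add_pos_of_pos_of_nonneg (pos hu) (nonneg v)

/-- Example showing that the `l_p` (0 < p ≤ 1) relaxation approach may fail to recover
the sparse solution: for `A(t₁,t₂,u,w) = t₁b¹ + t₂b² + αu + αw` and `b = b¹ + b²`,
the sparse solution `xˢ = (1,1,0,0)` of `Ax = b` satisfies `f(xˢ) = 2^{1/p}ν > ν =
f(x̄)` for `f(x) = ½‖Ax − b‖² + ν‖x‖_p`, so `xˢ` is not a global minimizer, and the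
relative error `(f(xˢ) − f*)/f*` is at least `2^{1/p} − 1 ≥ 1`. -/
theorem lp_relaxation_fails
    {n : ℕ} (p : ℝ) (hp0 : 0 < p) (hp1 : p ≤ 1)
    (b1 b2 : Fin n → ℝ) (hb12 : (b1, b2) ≠ 0)
    (ν : ℝ) (hν : 0 < ν)
    (α : ℝ) (hα : α = ((∑ i, |b1 i| ^ p) + ∑ i, |b2 i| ^ p) ^ (1 / p))
    (b : Fin n → ℝ) (hb : b = b1 + b2)
    -- the linear map A : ℝ^{2+2n} → ℝⁿ
    (A : ℝ × ℝ × (Fin n → ℝ) × (Fin n → ℝ) → Fin n → ℝ)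
    (hA : ∀ x i, A x i = x.1 * b1 i + x.2.1 * b2 i + α * x.2.2.1 i + α * x.2.2.2 i)
    -- the objective f(x) = ½‖Ax − b‖² + ν‖x‖_p
    (F : ℝ × ℝ × (Fin n → ℝ) × (Fin n → ℝ) → ℝ)
    (hF : ∀ x, F x = 1 / 2 * (∑ i, (A x i - b i) ^ 2) +
      ν * ((|x.1| ^ p + |x.2.1| ^ p + (∑ i, |x.2.2.1 i| ^ p) +
        ∑ i, |x.2.2.2 i| ^ p) ^ (1 / p)))
    (xs xbar : ℝ × ℝ × (Fin n → ℝ) × (Fin n → ℝ))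
    (hxs : xs = (1, 1, 0, 0))
    (hxbar : xbar = (0, 0, fun i => b1 i / α, fun i => b2 i / α)) :
    A xs = b ∧ A xbar = b ∧
    F xs = 2 ^ (1 / p) * ν ∧ F xbar = ν ∧
    F xbar < F xs ∧ ¬(∀ x, F xs ≤ F x) ∧
    (0 < sInf (Set.range F) →
      (2 : ℝ) ^ (1 / p) - 1 ≤ (F xs - sInf (Set.range F)) / sInf (Set.range F) ∧
      (1 : ℝ) ≤ (2 : ℝ) ^ (1 / p) - 1) := by
  set S : ℝ := (∑ i, |b1 i| ^ p) + ∑ i, |b2 i| ^ p with hS_def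
  have hS : 0 < S := sum_abs_rpow_add_sum_abs_rpow_pos p b1 b2 hb12
  have hα_pos : 0 < α := hα ▸ Real.rpow_pos_of_pos hS _
  have hα_pow : α ^ p = S := by
    rw [hα, ← Real.rpow_mul hS.le, one_div_mul_cancel hp0.ne', Real.rpow_one]
  have hAxs : A xs = b := by
    ext i
    simp [hA, hxs, hb]
  have hAxbar : A xbar = b := by
    ext i
    simp [hA, hxbar, hb, mul_div_cancel₀ _ hα_pos.ne']
  have hFxs : F xs = 2 ^ (1 / p) * ν := by
    rw [hF, hAxs, hxs]
    norm_num [Real.zero_rpow hp0.ne', mul_comm]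
  have hnorm : (∑ i, |b1 i / α| ^ p) + ∑ i, |b2 i / α| ^ p = 1 := by
    simp_rw [abs_div, abs_of_pos hα_pos, Real.div_rpow (abs_nonneg _) hα_pos.le, hα_pow,
      ← Finset.sum_div, ← add_div]
    exact div_self hS.ne'
  have hFxbar : F xbar = ν := by
    rw [hF, hAxbar, hxbar]
    simp [Real.zero_rpow hp0.ne', hnorm]
  have htwo : (2 : ℝ) ≤ 2 ^ (1 / p) :=
    Real.self_le_rpow_of_one_le one_le_two ((one_le_div hp0).mpr hp1)
  have hlt : F xbar < F xs := by
    rw [hFxs, hFxbar]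
    nlinarith
  refine ⟨hAxs, hAxbar, hFxs, hFxbar, hlt, fun h => (h xbar).not_gt hlt, fun hpos => ?_⟩
  have hbdd : BddBelow (Set.range F) := by
    refine ⟨0, ?_⟩
    rintro _ ⟨x, rfl⟩
    rw [hF]
    positivity
  have hinf : sInf (Set.range F) ≤ ν := hFxbar ▸ csInf_le hbdd (Set.mem_range_self xbar)
  refine ⟨?_, by linarith⟩
  rw [le_div_iff₀ hpos, hFxs]
  nlinarith
end
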